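/- Let X be a proper CAT(0) space and ξ ∈ ∂X a radial limit point: there is a sequence of isometries (gₙ) of X and a ray r₀ pointing to ξ such that gₙ⁻¹ r₀(0) converges to ξ while staying at bounded distance from r₀. Then the geometric dimension of the Tits boundary of the transverse space X_ξ satisfies dim(∂X_ξ) ≤ dim(∂X) − 1; in particular there is an isometric embedding ℝ × X_ξ → X. -/

import Mathlib

open Filter
open scoped ENNReal

/-- `m` is a midpoint of `a` and `b`. -/
def IsMidpoint {X : Type*} [MetricSpace X] (m a b : X) : Prop :=
  dist a m = dist a b / 2 ∧ dist b m = dist a b / 2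

/-- A complete metric space is CAT(0) if midpoints exist and the CN-inequality of
Bruhat–Tits holds. -/
class CAT0Space (X : Type*) [MetricSpace X] : Prop where
  midpoint_exists : ∀ a b : X, ∃ m, IsMidpoint m a b
  cn_ineq : ∀ x a b m : X, IsMidpoint m a b →
    dist x m ^ 2 ≤ (dist x a ^ 2 + dist x b ^ 2) / 2 - dist a b ^ 2 / 4

/-- `r` is a unit-speed geodesic ray (parametrised on `[0, ∞)`). -/
def IsGeodesicRay {X : Type*} [MetricSpace X] (r : ℝ → X) : Prop :=
  ∀ s t : ℝ, 0 ≤ s → 0 ≤ t → dist (r s) (r t) = |s - t|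

/-- Two rays are asymptotic (point to the same boundary point). -/
def Asymptotic {X : Type*} [MetricSpace X] (r r' : ℝ → X) : Prop :=
  ∃ M : ℝ, ∀ t : ℝ, 0 ≤ t → dist (r t) (r' t) ≤ M

/-- The infimal distance `d_ξ(r, r') = inf_{t,t'≥0} d(r(t), r'(t'))` between rays. -/
noncomputable def transDist {X : Type*} [MetricSpace X] (r r' : ℝ → X) : ℝ :=
  sInf {d : ℝ | ∃ t t' : ℝ, 0 ≤ t ∧ 0 ≤ t' ∧ d = dist (r t) (r' t')}

/-- The angular (Tits) distance between two geodesic rays issuing from a common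
basepoint. -/
noncomputable def angularDist {X : Type*} [MetricSpace X] (r r' : ℝ → X) : ℝ :=
  limUnder atTop (fun t : ℝ => 2 * Real.arcsin (dist (r t) (r' t) / (2 * t)))

/-- The Tits metric: the length metric associated to the angular metric, i.e. the infimum
of lengths of chains of rays from `r` to `r'` issuing from the basepoint `p`. -/
noncomputable def titsDist {X : Type*} [MetricSpace X] (p : X) (r r' : ℝ → X) : ℝ≥0∞ :=
  ⨅ nc : {nc : ℕ × (ℕ → ℝ → X) //
      nc.2 0 = r ∧ nc.2 nc.1 = r' ∧ ∀ i ≤ nc.1, IsGeodesicRay (nc.2 i) ∧ nc.2 i 0 = p},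
    ∑ i ∈ Finset.range nc.1.1, ENNReal.ofReal (angularDist (nc.1.2 i) (nc.1.2 (i + 1)))

/-- `B` together with `φ` is the Tits boundary of `X` with basepoint `p`: boundary points
are represented by geodesic rays from `p` and the extended distance is the Tits metric. -/
def IsTitsBoundary {X B : Type*} [MetricSpace X] [EMetricSpace B] (p : X)
    (φ : {r : ℝ → X // IsGeodesicRay r ∧ r 0 = p} → B) : Prop :=
  Function.Surjective φ ∧ ∀ r r', edist (φ r) (φ r') = titsDist p r.1 r'.1

/-- Covering dimension at most `n` (with `n = -1` corresponding to the empty space). -/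
def CovDimLE (Y : Type*) [TopologicalSpace Y] (n : ℤ) : Prop :=
  ∀ 𝒰 : Set (Set Y), (∀ U ∈ 𝒰, IsOpen U) → ⋃₀ 𝒰 = Set.univ →
    ∃ 𝒱 : Set (Set Y), (∀ V ∈ 𝒱, IsOpen V) ∧ ⋃₀ 𝒱 = Set.univ ∧
      (∀ V ∈ 𝒱, ∃ U ∈ 𝒰, V ⊆ U) ∧
      ∀ y : Y, {V ∈ 𝒱 | y ∈ V}.Finite ∧
        ({V ∈ 𝒱 | y ∈ V}).ncard ≤ (n + 1).toNat ∧ 0 ≤ n + 1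

/-- The geometric dimension of a boundary: the supremum over compact subsets of their
topological (covering) dimension is at most `d`. -/
def BoundaryDimLE (B : Type*) [EMetricSpace B] (d : ℤ) : Prop :=
  ∀ K : Set B, IsCompact K → CovDimLE K d

section

open Set Topology

section MidpointConvexity

/-- A continuous midpoint-convex function on `[0, k]` lies below its chord. -/
lemma le_chord_of_midpoint_convex {g : ℝ → ℝ} {k : ℝ} (hk : 0 < k)
    (hc : ContinuousOn g (Icc 0 k))
    (hm : ∀ s ∈ Icc 0 k, ∀ t ∈ Icc 0 k, g ((s + t) / 2) ≤ (g s + g t) / 2) :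
    ∀ t ∈ Icc 0 k, g t ≤ (1 - t / k) * g 0 + t / k * g k := by
  set h : ℝ → ℝ := fun t => g t - ((1 - t / k) * g 0 + t / k * g k) with hh
  have hhc : ContinuousOn h (Icc 0 k) := by
    apply hc.sub
    fun_prop
  have h0 : h 0 = 0 := by simp [hh]
  have hk0 : h k = 0 := by simp [hh, hk.ne']
  have hhm : ∀ s ∈ Icc 0 k, ∀ t ∈ Icc 0 k, h ((s + t) / 2) ≤ (h s + h t) / 2 := by
    intro s hs t ht
    have := hm s hs t ht
    simp only [hh]
    have e : (s + t) / 2 / k = (s / k + t / k) / 2 := by ring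
    rw [e]
    linarith
  intro t ht
  by_contra hcon
  have hpos : 0 < h t := by simp only [hh]; linarith
  obtain ⟨x0, hx0, hmax⟩ := isCompact_Icc.exists_isMaxOn ⟨t, ht⟩ hhc
  have hMpos : 0 < h x0 := lt_of_lt_of_le hpos (hmax ht)
  have hScl : IsCompact (Icc 0 k ∩ h ⁻¹' {h x0}) :=
    isCompact_Icc.of_isClosed_subset
      (hhc.preimage_isClosed_of_isClosed isClosed_Icc isClosed_singleton) inter_subset_left
  obtain ⟨x, ⟨hx, hxM⟩, hleast⟩ := hScl.exists_isLeast ⟨x0, hx0, rfl⟩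
  have hxM' : h x = h x0 := hxM
  have hxpos : 0 < x := by
    rcases hx.1.eq_or_lt with h' | h'
    · rw [← h', h0] at hxM'; linarith
    · exact h'
  have hxk : x < k := by
    rcases hx.2.eq_or_lt with h' | h'
    · rw [h', hk0] at hxM'; linarith
    · exact h'
  set δ := min x (k - x)
  have hδ : 0 < δ := lt_min hxpos (by linarith)
  have hδ1 : δ ≤ x := min_le_left _ _
  have hδ2 : δ ≤ k - x := min_le_right _ _
  have ha : x - δ ∈ Icc 0 k := ⟨by linarith, by linarith⟩
  have hb : x + δ ∈ Icc 0 k := ⟨by linarith, by linarith⟩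
  have h1 := hhm _ ha _ hb
  rw [show (x - δ + (x + δ)) / 2 = x by ring] at h1
  have h2 : h (x + δ) ≤ h x0 := hmax hb
  have h3 : h (x - δ) ≤ h x0 := hmax ha
  have h4 : h (x - δ) ≠ h x0 := fun e => by
    have := hleast ⟨ha, e⟩
    linarith
  have := lt_of_le_of_ne h3 h4
  linarith

/-- A bounded midpoint-convex function on `[0, ∞)` is nonincreasing. -/
lemma antitoneOn_of_midpoint_convex {g : ℝ → ℝ} {M : ℝ} (hM : ∀ t, 0 ≤ t → g t ≤ M)
    (hm : ∀ s t, 0 ≤ s → 0 ≤ t → g ((s + t) / 2) ≤ (g s + g t) / 2) :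
    AntitoneOn g (Ici 0) := by
  intro s hs t ht hst
  by_contra! hlt
  have hs : 0 ≤ s := hs
  set e := g t - g s with he
  have hepos : 0 < e := by linarith
  set h := t - s with hh
  have hh0 : 0 ≤ h := by linarith
  have step : ∀ n : ℕ, g s + n * e ≤ g (s + n * h) ∧
      e ≤ g (s + (n + 1 : ℕ) * h) - g (s + n * h) := by
    intro n
    induction n with
    | zero => simp [he, hh]
    | succ n ih =>
      obtain ⟨h1, h2⟩ := ih
      refine ⟨by push_cast at *; linarith, ?_⟩
      have := hm (s + n * h) (s + (n + 2 : ℕ) * h) (by positivity) (by positivity)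
      rw [show (s + n * h + (s + (n + 2 : ℕ) * h)) / 2 = s + (n + 1 : ℕ) * h by
        push_cast; ring] at this
      rw [show n + 1 + 1 = n + 2 from rfl]
      linarith
  obtain ⟨n, hn⟩ := exists_nat_gt ((M - g s) / e)
  rw [div_lt_iff₀ hepos] at hn
  have h1 := (step n).1
  have h2 := hM (s + n * h) (by positivity)
  linarith

end MidpointConvexity

section CAT0Basics

variable {X : Type*} [MetricSpace X]

lemma IsMidpoint.symm {m a b : X} (h : IsMidpoint m a b) : IsMidpoint m b a :=
  ⟨by rw [dist_comm b a]; exact h.2, by rw [dist_comm b a]; exact h.1⟩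

/-- Existence of points satisfying the CN inequality implies the CAT(0) condition. -/
lemma CAT0Space.of_exists_cn
    (h : ∀ a b : X, ∃ m : X, ∀ x : X,
      dist x m ^ 2 ≤ (dist x a ^ 2 + dist x b ^ 2) / 2 - dist a b ^ 2 / 4) : CAT0Space X := by
  have key : ∀ a b m : X, (∀ x : X,
      dist x m ^ 2 ≤ (dist x a ^ 2 + dist x b ^ 2) / 2 - dist a b ^ 2 / 4) →
      IsMidpoint m a b := by
    intro a b m hm
    have h1 := hm a
    have h2 := hm b
    simp only [dist_self, dist_comm b a] at h1 h2
    have d0 : 0 ≤ dist a b := dist_nonneg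
    have e1 : dist a m ≤ dist a b / 2 := by
      apply le_of_sq_le_sq _ (by positivity)
      linarith
    have e2 : dist b m ≤ dist a b / 2 := by
      apply le_of_sq_le_sq _ (by positivity)
      linarith
    have h3 := dist_triangle a m b
    rw [dist_comm m b] at h3
    exact ⟨by linarith, by linarith⟩
  refine ⟨fun a b => ?_, fun x a b m hm => ?_⟩
  · obtain ⟨m, hm⟩ := h a b
    exact ⟨m, key a b m hm⟩
  · obtain ⟨m', hm'⟩ := h a b
    have h1 := hm' m
    rw [dist_comm m a, dist_comm m b, hm.1, hm.2] at h1
    have : dist m m' = 0 := by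
      have : dist m m' ^ 2 ≤ 0 := by linarith
      nlinarith [@dist_nonneg _ _ m m']
    rw [dist_eq_zero.mp this]
    exact hm' x

/-- `c` has constant speed `v` on the set `S`. -/
def HasSpeedOn (c : ℝ → X) (v : ℝ) (S : Set ℝ) : Prop :=
  ∀ s ∈ S, ∀ t ∈ S, dist (c s) (c t) = v * |s - t|

lemma HasSpeedOn.mono {c : ℝ → X} {v : ℝ} {S S' : Set ℝ} (h : HasSpeedOn c v S) (hS : S' ⊆ S) :
    HasSpeedOn c v S' := fun s hs t ht => h s (hS hs) t (hS ht)

lemma HasSpeedOn.continuousOn {c : ℝ → X} {v : ℝ} {S : Set ℝ} (h : HasSpeedOn c v S) :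
    ContinuousOn c S := by
  have : LipschitzOnWith (Real.toNNReal |v|) c S := by
    apply LipschitzOnWith.of_dist_le_mul
    intro s hs t ht
    rw [h s hs t ht, Real.coe_toNNReal _ (abs_nonneg v), Real.dist_eq]
    gcongr
    exact le_abs_self v
  exact this.continuousOn

lemma HasSpeedOn.isMidpoint {c : ℝ → X} {v : ℝ} {S : Set ℝ} (h : HasSpeedOn c v S) {s t : ℝ}
    (hs : s ∈ S) (ht : t ∈ S) (hst : (s + t) / 2 ∈ S) :
    IsMidpoint (c ((s + t) / 2)) (c s) (c t) := by
  constructor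
  · rw [h s hs _ hst, h s hs t ht, show s - (s + t) / 2 = (s - t) / 2 by ring, abs_div]
    norm_num
    ring
  · rw [h t ht _ hst, h s hs t ht, show t - (s + t) / 2 = -((s - t) / 2) by ring, abs_neg, abs_div]
    norm_num
    ring

variable [CAT0Space X]

/-- The sum of the squares of the diagonals of a quadrilateral is at most the sum of the squares
of its sides. -/
lemma CAT0Space.quadrilateral (a b c d : X) :
    dist a d ^ 2 + dist b c ^ 2 ≤
      dist a b ^ 2 + dist b d ^ 2 + dist d c ^ 2 + dist c a ^ 2 := by
  obtain ⟨m, hm⟩ := CAT0Space.midpoint_exists a d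
  have h1 := CAT0Space.cn_ineq b a d m hm
  have h2 := CAT0Space.cn_ineq c a d m hm
  have h3 := dist_triangle b m c
  rw [dist_comm m c] at h3
  rw [dist_comm b a] at h1
  rw [dist_comm c d] at h2
  have h4 : dist b c ^ 2 ≤ 2 * dist b m ^ 2 + 2 * dist c m ^ 2 := by
    nlinarith [sq_nonneg (dist b m - dist c m), @dist_nonneg _ _ b c, @dist_nonneg _ _ b m,
      @dist_nonneg _ _ c m]
  linarith

lemma IsMidpoint.dist_le_of_common {m m' a b b' : X} (h : IsMidpoint m a b)
    (h' : IsMidpoint m' a b') : dist m m' ≤ dist b b' / 2 := by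
  have h1 := CAT0Space.cn_ineq m a b' m' h'
  have h2 := CAT0Space.cn_ineq b' a b m h
  rw [dist_comm m a, dist_comm m b', h.1] at h1
  rw [dist_comm b' a, dist_comm b' b] at h2
  apply le_of_sq_le_sq _ (by positivity)
  nlinarith

lemma IsMidpoint.dist_le {m m' a b a' b' : X} (h : IsMidpoint m a b)
    (h' : IsMidpoint m' a' b') : dist m m' ≤ (dist a a' + dist b b') / 2 := by
  obtain ⟨z, hz⟩ := CAT0Space.midpoint_exists a b'
  have h1 := h.dist_le_of_common hz
  have h2 := hz.symm.dist_le_of_common h'.symm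
  have := dist_triangle m z m'
  linarith

/-- The distance between two constant speed geodesics is convex. -/
lemma HasSpeedOn.dist_le_chord {c w : ℝ → X} {v u k : ℝ} (hk : 0 < k)
    (hc : HasSpeedOn c v (Icc 0 k)) (hw : HasSpeedOn w u (Icc 0 k)) {t : ℝ} (ht : t ∈ Icc 0 k) :
    dist (c t) (w t) ≤ (1 - t / k) * dist (c 0) (w 0) + t / k * dist (c k) (w k) := by
  refine le_chord_of_midpoint_convex (g := fun t => dist (c t) (w t)) hk
    (continuous_dist.comp_continuousOn (hc.continuousOn.prodMk hw.continuousOn)) ?_ t ht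
  intro s hs t ht
  have hst : (s + t) / 2 ∈ Icc 0 k := ⟨by linarith [hs.1, ht.1], by linarith [hs.2, ht.2]⟩
  exact (hc.isMidpoint hs ht hst).dist_le (hw.isMidpoint hs ht hst)

/-- The CN inequality at an arbitrary point of a geodesic. -/
lemma HasSpeedOn.stewart {c : ℝ → X} {v k : ℝ} (hk : 0 < k)
    (hc : HasSpeedOn c v (Icc 0 k)) (x : X) {t : ℝ} (ht : t ∈ Icc 0 k) :
    dist x (c t) ^ 2 ≤ (1 - t / k) * dist x (c 0) ^ 2 + t / k * dist x (c k) ^ 2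
      - v ^ 2 * t * (k - t) := by
  have := le_chord_of_midpoint_convex (g := fun t => dist x (c t) ^ 2 - v ^ 2 * t ^ 2) hk
    (by
      have := hc.continuousOn
      fun_prop) ?_ t ht
  · have e : t / k * (dist x (c k) ^ 2 - v ^ 2 * k ^ 2)
      = t / k * dist x (c k) ^ 2 - v ^ 2 * t * k := by
      field_simp
    rw [e] at this
    nlinarith
  · intro s hs t ht
    have hst : (s + t) / 2 ∈ Icc 0 k := ⟨by linarith [hs.1, ht.1], by linarith [hs.2, ht.2]⟩
    have h1 := CAT0Space.cn_ineq x _ _ _ (hc.isMidpoint hs ht hst)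
    rw [hc s hs t ht, mul_pow, sq_abs] at h1
    nlinarith

end CAT0Basics

section Ultralimits

variable {X : Type*} [MetricSpace X]

lemma exists_ultralimit [ProperSpace X] (U : Ultrafilter ℕ) {x : ℕ → X} (p : X) (R : ℝ)
    (h : ∀ᶠ n in (U : Filter ℕ), dist (x n) p ≤ R) :
    ∃ y, Tendsto x (U : Filter ℕ) (𝓝 y) := by
  obtain ⟨y, -, hy⟩ := (isCompact_closedBall p R).ultrafilter_le_nhds (U.map x)
    (le_principal_iff.mpr h)
  exact ⟨y, hy⟩

lemma dist_eq_of_equal_steps {P : ℕ → X} {N : ℕ} {e : ℝ}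
    (h : ∀ i < N, dist (P i) (P (i + 1)) = e) (hN : dist (P 0) (P N) = N * e) {i j : ℕ}
    (hij : i ≤ j) (hj : j ≤ N) : dist (P i) (P j) = (j - i) * e := by
  have key : ∀ i j, i ≤ j → j ≤ N → dist (P i) (P j) ≤ (j - i) * e := by
    intro i j hij hj
    induction j, hij using Nat.le_induction with
    | base => simp
    | succ j hij ih =>
      have h1 := ih (by omega)
      have h2 := h j (by omega)
      have h3 := dist_triangle (P i) (P j) (P (j + 1))
      push_cast
      linarith
  have h1 := key i j hij hj
  have h2 := key 0 i (by omega) (by omega)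
  have h3 := key j N hj le_rfl
  have h4 := dist_triangle4 (P 0) (P i) (P j) (P N)
  push_cast at h2
  apply le_antisymm h1
  linarith

variable [CAT0Space X]

lemma exists_dyadic_geodesic (n : ℕ) (a b : X) : ∃ P : ℕ → X, P 0 = a ∧ P (2 ^ n) = b ∧
    ∀ i < 2 ^ n, dist (P i) (P (i + 1)) = dist a b / 2 ^ n := by
  induction n generalizing a b with
  | zero => exact ⟨fun i => if i = 0 then a else b, by simp⟩
  | succ n ih =>
    obtain ⟨m, hm⟩ := CAT0Space.midpoint_exists a b
    obtain ⟨P, hP0, hP1, hP⟩ := ih a m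
    obtain ⟨Q, hQ0, hQ1, hQ⟩ := ih m b
    refine ⟨fun i => if i ≤ 2 ^ n then P i else Q (i - 2 ^ n), by simp [hP0], ?_, ?_⟩
    · have h2 : ¬ (2 ^ (n + 1) ≤ 2 ^ n) := by
        rw [pow_succ]; have : 0 < 2 ^ n := by positivity
        omega
      simp only [h2, if_false]
      rw [show 2 ^ (n + 1) - 2 ^ n = 2 ^ n by rw [pow_succ]; omega, hQ1]
    · intro i hi
      rw [pow_succ] at hi
      rcases lt_trichotomy i (2 ^ n) with h | h | h
      · simp only [h.le, if_true, show i + 1 ≤ 2 ^ n from h]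
        rw [hP i h, hm.1, pow_succ]
        field_simp
      · subst h
        simp only [le_refl, if_true, show ¬ (2 ^ n + 1 ≤ 2 ^ n) by omega, if_false]
        rw [hP1, ← hQ0, show 2 ^ n + 1 - 2 ^ n = 0 + 1 by omega, hQ 0 (by positivity),
          dist_comm m b, hm.2, pow_succ]
        field_simp
      · simp only [show ¬ (i ≤ 2 ^ n) by omega, if_false, show ¬ (i + 1 ≤ 2 ^ n) by omega]
        rw [show i + 1 - 2 ^ n = (i - 2 ^ n) + 1 by omega, hQ _ (by omega), dist_comm m b, hm.2,
          pow_succ]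
        field_simp

/-- Geodesics exist in a proper CAT(0) space. -/
lemma exists_geodesic [ProperSpace X] (a b : X) {k : ℝ} (hk : 0 < k) :
    ∃ c : ℝ → X, c 0 = a ∧ c k = b ∧ HasSpeedOn c (dist a b / k) (Icc 0 k) := by
  choose P hP0 hP1 hP using fun n => exists_dyadic_geodesic n a b
  set ix : ℕ → ℝ → ℕ := fun n s => ⌊s / k * (2 : ℝ) ^ n⌋₊ with hix
  have hle : ∀ n, ∀ s ∈ Icc 0 k, ix n s ≤ 2 ^ n := by
    intro n s hs
    apply Nat.floor_le_of_le
    have : s / k ≤ 1 := (div_le_one hk).mpr hs.2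
    push_cast
    nlinarith [pow_pos (show (0 : ℝ) < 2 by norm_num) n]
  have hd : ∀ n i j, i ≤ 2 ^ n → j ≤ 2 ^ n →
      dist (P n i) (P n j) = |(i : ℝ) - j| * (dist a b / 2 ^ n) := by
    intro n i j hi hj
    have hN : dist (P n 0) (P n (2 ^ n)) = ((2 ^ n : ℕ) : ℝ) * (dist a b / 2 ^ n) := by
      rw [hP0, hP1]; push_cast; field_simp
    rcases le_total i j with h | h
    · rw [dist_eq_of_equal_steps (hP n) hN h hj, abs_sub_comm, abs_of_nonneg]
      simpa using h
    · rw [dist_comm, dist_eq_of_equal_steps (hP n) hN h hi, abs_of_nonneg]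
      simpa using h
  have hlim : ∀ s ∈ Icc 0 k, Tendsto (fun n => (ix n s : ℝ) / 2 ^ n) atTop (𝓝 (s / k)) := by
    intro s hs
    have h1 := (tendsto_nat_floor_mul_div_atTop (R := ℝ) (div_nonneg hs.1 hk.le)).comp
      (tendsto_pow_atTop_atTop_of_one_lt (one_lt_two (α := ℝ)))
    exact h1
  have hex : ∀ s, ∃ y, s ∈ Icc 0 k →
      Tendsto (fun n => P n (ix n s)) (hyperfilter ℕ : Filter ℕ) (𝓝 y) := by
    intro s
    by_cases hs : s ∈ Icc 0 k
    · obtain ⟨y, hy⟩ := exists_ultralimit (hyperfilter ℕ) (x := fun n => P n (ix n s)) a (dist a b)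
        (Eventually.of_forall fun n => by
          rw [← hP0 n, hd n _ _ (hle n s hs) (Nat.zero_le _), hP0]
          have : (ix n s : ℝ) ≤ 2 ^ n := by exact_mod_cast hle n s hs
          simp only [Nat.cast_zero, sub_zero, Nat.abs_cast]
          rw [mul_div_assoc', div_le_iff₀ (by positivity), mul_comm]
          gcongr)
      exact ⟨y, fun _ => hy⟩
    · exact ⟨a, fun h => absurd h hs⟩
  choose c hc using hex
  have h0 : (0 : ℝ) ∈ Icc 0 k := ⟨le_rfl, hk.le⟩
  have hkk : k ∈ Icc 0 k := ⟨hk.le, le_rfl⟩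
  refine ⟨c, ?_, ?_, ?_⟩
  · refine tendsto_nhds_unique (hc 0 h0) (tendsto_const_nhds.congr fun n => ?_)
    simp [hix, hP0]
  · refine tendsto_nhds_unique (hc k hkk) (tendsto_const_nhds.congr fun n => ?_)
    have : ix n k = 2 ^ n := by
      simp only [hix, div_self hk.ne', one_mul]
      exact_mod_cast Nat.floor_natCast (R := ℝ) (2 ^ n)
    rw [this, hP1]
  · intro s hs t ht
    refine tendsto_nhds_unique ((hc s hs).dist (hc t ht)) ?_
    have h1 : Tendsto (fun n => |(ix n s : ℝ) / 2 ^ n - (ix n t : ℝ) / 2 ^ n| * dist a b)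
        atTop (𝓝 (|s / k - t / k| * dist a b)) :=
      (((hlim s hs).sub (hlim t ht)).abs).mul_const _
    have e : |s / k - t / k| * dist a b = dist a b / k * |s - t| := by
      rw [← sub_div, abs_div, abs_of_pos hk]; ring
    rw [e] at h1
    refine (h1.mono_left Nat.hyperfilter_le_atTop).congr fun n => ?_
    rw [hd n _ _ (hle n s hs) (hle n t ht), ← sub_div, abs_div,
      abs_of_pos (show (0 : ℝ) < 2 ^ n by positivity)]
    ring

/-- Geodesics from `p` to `m n`, parametrised on `[0, n]`, subconverge to a ray of constant speed,
whose distance to any given ray of constant speed is controlled. -/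
lemma exists_limit_ray [ProperSpace X] (p : X) (m : ℕ → X) {v : ℝ}
    (hv : Tendsto (fun n => dist p (m n) / n) (hyperfilter ℕ : Filter ℕ) (𝓝 v)) :
    ∃ c : ℝ → X, c 0 = p ∧ HasSpeedOn c v (Ici 0) ∧
      ∀ (w : ℝ → X) (u : ℝ), HasSpeedOn w u (Ici 0) → ∀ (t : ℝ), 0 ≤ t → ∀ (B : ℕ → ℝ) (R : ℝ),
        Tendsto B (hyperfilter ℕ : Filter ℕ) (𝓝 R) →
        (∀ᶠ n : ℕ in (hyperfilter ℕ : Filter ℕ),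
          (1 - t / n) * dist p (w 0) + t / n * dist (m n) (w n) ≤ B n) →
        dist (c t) (w t) ≤ R := by
  have hpos : ∀ n : ℕ, (0 : ℝ) < n + 1 := fun n => by positivity
  have hex0 : ∀ n : ℕ, ∃ γ : ℝ → X, 0 < n →
      γ 0 = p ∧ γ n = m n ∧ HasSpeedOn γ (dist p (m n) / n) (Icc 0 n) := by
    intro n
    rcases Nat.eq_zero_or_pos n with h | h
    · exact ⟨fun _ => p, fun h' => by omega⟩
    · obtain ⟨γ, h1, h2, h3⟩ := exists_geodesic p (m n) (k := n) (by exact_mod_cast h)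
      exact ⟨γ, fun _ => ⟨h1, h2, h3⟩⟩
  choose γ hγ using hex0
  have hlarge : ∀ t : ℝ, ∀ᶠ n : ℕ in (hyperfilter ℕ : Filter ℕ), 0 < n ∧ t ≤ n := by
    intro t
    apply Nat.hyperfilter_le_atTop
    filter_upwards [eventually_gt_atTop 0, tendsto_natCast_atTop_atTop.eventually_ge_atTop t]
      with n h1 h2 using ⟨h1, h2⟩
  have hbd : ∀ᶠ n : ℕ in (hyperfilter ℕ : Filter ℕ), dist p (m n) / n ≤ v + 1 :=
    hv.eventually_le_const (by linarith)
  have hex : ∀ t, ∃ y, 0 ≤ t → Tendsto (fun n => γ n t) (hyperfilter ℕ : Filter ℕ) (𝓝 y) := by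
    intro t
    by_cases ht : 0 ≤ t
    · obtain ⟨y, hy⟩ := exists_ultralimit (hyperfilter ℕ) (x := fun n => γ n t) p ((v + 1) * t) (by
        filter_upwards [hlarge t, hbd] with n h1 h2
        obtain ⟨g0, g1, g2⟩ := hγ n h1.1
        rw [← g0, g2 t ⟨ht, h1.2⟩ 0 ⟨le_rfl, by positivity⟩, sub_zero, abs_of_nonneg ht]
        gcongr)
      exact ⟨y, fun _ => hy⟩
    · exact ⟨p, fun h => absurd h ht⟩
  choose c hc using hex
  refine ⟨c, ?_, ?_, ?_⟩
  · refine tendsto_nhds_unique (hc 0 le_rfl) (tendsto_const_nhds.congr' ?_)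
    filter_upwards [hlarge 0] with n h1 using (hγ n h1.1).1.symm
  · intro s hs t ht
    refine tendsto_nhds_unique ((hc s hs).dist (hc t ht)) ((hv.mul_const |s - t|).congr' ?_)
    filter_upwards [hlarge s, hlarge t] with n h1 h2
    exact ((hγ n h1.1).2.2 s ⟨hs, h1.2⟩ t ⟨ht, h2.2⟩).symm
  · intro w u hw t ht B R hB hle
    refine le_of_tendsto_of_tendsto ((hc t ht).dist tendsto_const_nhds) hB ?_
    filter_upwards [hlarge t, hle] with n h1 h2
    obtain ⟨g0, g1, g2⟩ := hγ n h1.1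
    have := HasSpeedOn.dist_le_chord (k := n) (by exact_mod_cast h1.1) g2
      (hw.mono Icc_subset_Ici_self) ⟨ht, h1.2⟩
    rw [g0, g1] at this
    exact this.trans h2

lemma IsGeodesicRay.hasSpeedOn {X : Type*} [MetricSpace X] {r : ℝ → X} (h : IsGeodesicRay r) :
    HasSpeedOn r 1 (Ici 0) := fun s hs t ht => by rw [h s t hs ht, one_mul]

/-- Through every point there is a ray asymptotic to a given one; it stays within the initial
distance. -/
lemma exists_asymptotic_ray [ProperSpace X] {r : ℝ → X} (hr : IsGeodesicRay r) (p : X) :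
    ∃ r' : ℝ → X, IsGeodesicRay r' ∧ r' 0 = p ∧ ∀ t, 0 ≤ t → dist (r' t) (r t) ≤ dist p (r 0) := by
  have hv : Tendsto (fun n : ℕ => dist p (r n) / n) atTop (𝓝 1) := by
    have h0 : Tendsto (fun n : ℕ => dist p (r 0) / (n : ℝ)) atTop (𝓝 0) :=
      tendsto_const_nhds.div_atTop tendsto_natCast_atTop_atTop
    have h1 : Tendsto (fun n : ℕ => 1 - dist p (r 0) / (n : ℝ)) atTop (𝓝 1) := by
      simpa using h0.const_sub 1
    have h2 : Tendsto (fun n : ℕ => 1 + dist p (r 0) / (n : ℝ)) atTop (𝓝 1) := by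
      simpa using h0.const_add 1
    refine tendsto_of_tendsto_of_tendsto_of_le_of_le' h1 h2 ?_ ?_
    all_goals
      filter_upwards [eventually_gt_atTop 0] with n hn
      have hn' : (0 : ℝ) < n := by exact_mod_cast hn
      have e : dist (r 0) (r n) = n := by
        rw [hr 0 n le_rfl hn'.le, zero_sub, abs_neg, abs_of_pos hn']
    · rw [le_div_iff₀ hn', sub_mul, div_mul_cancel₀ _ hn'.ne']
      have := dist_triangle (r 0) p (r n)
      rw [dist_comm (r 0) p] at this
      linarith
    · rw [div_le_iff₀ hn', add_mul, div_mul_cancel₀ _ hn'.ne']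
      have := dist_triangle p (r 0) (r n)
      linarith
  obtain ⟨c, h1, h2, h3⟩ := exists_limit_ray p (fun n => r n)
    (hv.mono_left Nat.hyperfilter_le_atTop)
  refine ⟨c, fun s t hs ht => by rw [h2 s hs t ht, one_mul], h1, fun t ht => ?_⟩
  refine h3 r 1 hr.hasSpeedOn t ht (fun _ => dist p (r 0)) _ tendsto_const_nhds ?_
  refine Eventually.of_forall fun n => ?_
  simp only [dist_self, mul_zero, add_zero]
  have : 0 ≤ t / n := by positivity
  nlinarith [@dist_nonneg _ _ p (r 0)]

end Ultralimits

section AsymptoticRays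

variable {X : Type*} [MetricSpace X]

lemma Asymptotic.symm {r r' : ℝ → X} (h : Asymptotic r r') : Asymptotic r' r := by
  obtain ⟨M, hM⟩ := h
  exact ⟨M, fun t ht => by rw [dist_comm]; exact hM t ht⟩

lemma Asymptotic.trans {r r' r'' : ℝ → X} (h : Asymptotic r r') (h' : Asymptotic r' r'') :
    Asymptotic r r'' := by
  obtain ⟨M, hM⟩ := h
  obtain ⟨M', hM'⟩ := h'
  exact ⟨M + M', fun t ht => (dist_triangle _ (r' t) _).trans (add_le_add (hM t ht) (hM' t ht))⟩

variable [CAT0Space X]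

lemma antitoneOn_dist_asymptotic {r r' : ℝ → X} (hr : IsGeodesicRay r) (hr' : IsGeodesicRay r')
    (h : Asymptotic r r') {s s' : ℝ} (hs : 0 ≤ s) (hs' : 0 ≤ s') :
    AntitoneOn (fun t => dist (r (t + s)) (r' (t + s'))) (Ici 0) := by
  obtain ⟨M, hM⟩ := h
  refine antitoneOn_of_midpoint_convex (M := |s - s'| + M) ?_ ?_
  · intro t ht
    have h1 := dist_triangle (r (t + s)) (r (t + s')) (r' (t + s'))
    rw [hr _ _ (by positivity) (by positivity), show t + s - (t + s') = s - s' by ring] at h1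
    exact h1.trans (by gcongr; exact hM _ (by positivity))
  · intro x y hx hy
    have h1 := hr.hasSpeedOn.isMidpoint (s := x + s) (t := y + s) (mem_Ici.mpr (by positivity))
      (mem_Ici.mpr (by positivity)) (mem_Ici.mpr (by positivity))
    have h2 := hr'.hasSpeedOn.isMidpoint (s := x + s') (t := y + s') (mem_Ici.mpr (by positivity))
      (mem_Ici.mpr (by positivity)) (mem_Ici.mpr (by positivity))
    have := h1.dist_le h2
    rwa [show (x + s + (y + s)) / 2 = (x + y) / 2 + s by ring,
      show (x + s' + (y + s')) / 2 = (x + y) / 2 + s' by ring] at this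

lemma exists_tendsto_dist_asymptotic {r r' : ℝ → X} (hr : IsGeodesicRay r)
    (hr' : IsGeodesicRay r') (h : Asymptotic r r') (s s' : ℝ) :
    ∃ l, Tendsto (fun t => dist (r (t + s)) (r' (t + s'))) atTop (𝓝 l) := by
  set T := |s| + |s'| with hT
  have h1 : 0 ≤ T + s := by linarith [neg_abs_le s, abs_nonneg s']
  have h2 : 0 ≤ T + s' := by linarith [neg_abs_le s', abs_nonneg s]
  have hanti := antitoneOn_dist_asymptotic hr hr' h h1 h2
  set G : ℝ → ℝ := fun t => dist (r (max t 0 + (T + s))) (r' (max t 0 + (T + s'))) with hG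
  have hGa : Antitone G := fun x y hxy =>
    hanti (mem_Ici.mpr (le_max_right _ _)) (mem_Ici.mpr (le_max_right _ _))
      (max_le_max_right 0 hxy)
  have hlim := tendsto_atTop_ciInf hGa ⟨0, by rintro _ ⟨t, rfl⟩; exact dist_nonneg⟩
  refine ⟨_, (hlim.comp (tendsto_atTop_add_const_right atTop (-T) tendsto_id)).congr' ?_⟩
  filter_upwards [eventually_ge_atTop T] with t ht
  simp only [hG, Function.comp, id]
  rw [max_eq_left (by linarith), show t + -T + (T + s) = t + s by ring,
    show t + -T + (T + s') = t + s' by ring]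

/-- The distance function between asymptotic rays is asymptotically the one between parallel lines
in the plane, at distance `transDist`. -/
lemma exists_flat_asymptotics {r r' : ℝ → X} (hr : IsGeodesicRay r)
    (hr' : IsGeodesicRay r') (h : Asymptotic r r') :
    ∃ b : ℝ, ∀ s s' : ℝ, Tendsto (fun t => dist (r (t + s)) (r' (t + s'))) atTop
      (𝓝 (Real.sqrt ((s - s' - b) ^ 2 + transDist r r' ^ 2))) := by
  choose φ' hφ' using exists_tendsto_dist_asymptotic hr hr' h
  set φ : ℝ → ℝ := fun δ => φ' δ 0 with hφdef
  have hφ : ∀ s s', Tendsto (fun t => dist (r (t + s)) (r' (t + s'))) atTop (𝓝 (φ (s - s'))) := by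
    intro s s'
    refine ((hφ' (s - s') 0).comp (tendsto_atTop_add_const_right atTop s' tendsto_id)).congr ?_
    intro t
    simp only [Function.comp, id]
    rw [show t + s' + (s - s') = t + s by ring, add_zero]
  have hφ0 : ∀ δ, 0 ≤ φ δ := fun δ =>
    ge_of_tendsto' (hφ' δ 0) fun t => dist_nonneg
  have hlarge : ∀ s : ℝ, ∀ᶠ t : ℝ in atTop, 0 ≤ t + s := fun s => by
    filter_upwards [eventually_ge_atTop (-s)] with t ht using by linarith
  have hle : ∀ t t', 0 ≤ t → 0 ≤ t' → φ (t - t') ≤ dist (r t) (r' t') := by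
    intro t t' ht ht'
    refine le_of_tendsto (hφ t t') ?_
    filter_upwards [eventually_ge_atTop 0] with u hu
    have := antitoneOn_dist_asymptotic hr hr' h ht ht' (mem_Ici.mpr le_rfl) hu hu
    simpa using this
  have hconv : ∀ x h : ℝ, 2 * φ x ^ 2 ≤ φ (x + h) ^ 2 + φ (x - h) ^ 2 - 2 * h ^ 2 := by
    intro x h
    have h1 := ((hφ x 0).pow 2).const_mul 2
    have h2 := ((((hφ (x + h) 0).pow 2).add ((hφ (x - h) 0).pow 2)).sub_const (2 * h ^ 2))
    simp only [sub_zero] at h1 h2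
    refine le_of_tendsto_of_tendsto h1 h2 ?_
    filter_upwards [hlarge (x + h), hlarge (x - h)] with t ht1 ht2
    have hm := hr.hasSpeedOn.isMidpoint (s := t + (x + h)) (t := t + (x - h)) ht1 ht2
      (mem_Ici.mpr (by linarith))
    have := CAT0Space.cn_ineq (r' (t + 0)) _ _ _ hm
    rw [hr _ _ ht1 ht2, show t + (x + h) - (t + (x - h)) = 2 * h by ring, sq_abs,
      show (t + (x + h) + (t + (x - h))) / 2 = t + x by ring] at this
    simp only [dist_comm (r' (t + 0))] at this
    linarith
  have hconc : ∀ x h : ℝ, φ (x + h) ^ 2 + φ (x - h) ^ 2 ≤ 2 * φ x ^ 2 + 2 * h ^ 2 := by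
    intro x h
    have h1 := ((hφ (x + h) 0).pow 2).add ((hφ x h).pow 2)
    have h2 := (((hφ x 0).pow 2).add ((hφ (x + h) h).pow 2)).add_const (2 * h ^ 2)
    simp only [sub_zero, add_sub_cancel_right, ← two_mul] at h1 h2
    refine le_of_tendsto_of_tendsto h1 h2 ?_
    filter_upwards [hlarge (x + h), hlarge x, hlarge h, hlarge 0] with t ht1 ht2 ht3 ht4
    have := CAT0Space.quadrilateral (r (t + (x + h))) (r (t + x)) (r' (t + h)) (r' (t + 0))
    rw [hr _ _ ht1 ht2, hr' _ _ ht4 ht3, show t + (x + h) - (t + x) = h by ring,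
      show t + 0 - (t + h) = -h by ring, sq_abs, sq_abs, dist_comm (r' (t + h))] at this
    linarith
  have hlip : ∀ δ δ', φ δ ≤ φ δ' + |δ - δ'| := by
    intro δ δ'
    have h1 := (hφ δ' 0).add_const |δ - δ'|
    have h2 := hφ δ 0
    simp only [sub_zero] at h1 h2
    refine le_of_tendsto_of_tendsto h2 h1 ?_
    filter_upwards [hlarge δ, hlarge δ'] with t ht1 ht2
    have := dist_triangle (r (t + δ)) (r (t + δ')) (r' (t + 0))
    rw [hr _ _ ht1 ht2, show t + δ - (t + δ') = δ - δ' by ring] at this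
    linarith
  have hcont : Continuous φ := by
    have : LipschitzWith 1 φ := LipschitzWith.of_le_add fun x y => by
      rw [Real.dist_eq]; exact hlip x y
    exact this.continuous
  set g : ℝ → ℝ := fun x => φ x ^ 2 - x ^ 2 with hg
  have hJ : ∀ x h, g (x + h) + g (x - h) = 2 * g x := by
    intro x h
    have h1 := hconv x h
    have h2 := hconc x h
    simp only [hg]
    nlinarith
  have hadd : ∀ x y, g (x + y) - g 0 = (g x - g 0) + (g y - g 0) := by
    intro x y
    have h1 := hJ ((x + y) / 2) ((x - y) / 2)
    have h2 := hJ ((x + y) / 2) ((x + y) / 2)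
    rw [show (x + y) / 2 + (x - y) / 2 = x by ring, show (x + y) / 2 - (x - y) / 2 = y by ring]
      at h1
    rw [sub_self, add_halves] at h2
    linarith
  let L : ℝ →+ ℝ := AddMonoidHom.mk' (fun x => g x - g 0) hadd
  have hL : Continuous L := by
    change Continuous fun x => g x - g 0
    fun_prop
  have hlin : ∀ x, g x - g 0 = x * (g 1 - g 0) := by
    intro x
    have := map_real_smul L hL x 1
    simpa [L] using this
  set c := g 1 - g 0 with hc
  set b := -(c / 2) with hb
  have hq : ∀ x, φ x ^ 2 = (x - b) ^ 2 + φ b ^ 2 := by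
    intro x
    have h1 := hlin x
    have h2 := hlin b
    simp only [hg] at h1 h2
    have hcb : c = -2 * b := by rw [hb]; ring
    linear_combination h1 - h2 + (x - b) * hcb
  have hmin : ∀ x, φ b ≤ φ x := fun x => by
    apply le_of_sq_le_sq _ (hφ0 x)
    rw [hq x]
    nlinarith [sq_nonneg (x - b)]
  have hD : transDist r r' = φ b := by
    apply le_antisymm
    · apply le_of_forall_gt_imp_ge_of_dense
      intro a ha
      have h1 := (hφ b 0).eventually (gt_mem_nhds (by simpa using ha))
      obtain ⟨t, h2, h3, h4⟩ := (h1.and ((hlarge b).and (hlarge 0))).exists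
      refine le_trans (csInf_le ⟨0, ?_⟩ ⟨_, _, h3, h4, rfl⟩) h2.le
      rintro _ ⟨_, _, _, _, rfl⟩
      exact dist_nonneg
    · refine le_csInf ⟨_, 0, 0, le_rfl, le_rfl, rfl⟩ ?_
      rintro _ ⟨t, t', ht, ht', rfl⟩
      exact (hmin _).trans (hle t t' ht ht')
  refine ⟨b, fun s s' => ?_⟩
  rw [hD, ← hq, Real.sqrt_sq (hφ0 _)]
  exact hφ s s'

lemma tendsto_sqrt_sq_add_sub (D : ℝ) :
    Tendsto (fun x : ℝ => Real.sqrt (x ^ 2 + D ^ 2) - x) atTop (𝓝 0) := by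
  have h0 : Tendsto (fun x : ℝ => D ^ 2 / x) atTop (𝓝 0) :=
    tendsto_const_nhds.div_atTop tendsto_id
  refine tendsto_of_tendsto_of_tendsto_of_le_of_le' tendsto_const_nhds h0 ?_ ?_
  · filter_upwards [eventually_ge_atTop 0] with x hx
    rw [sub_nonneg]
    apply Real.le_sqrt_of_sq_le
    nlinarith [sq_nonneg D]
  · filter_upwards [eventually_gt_atTop 0] with x hx
    rw [sub_le_iff_le_add]
    apply Real.sqrt_le_iff.mpr
    refine ⟨by positivity, ?_⟩
    have : (D ^ 2 / x + x) ^ 2 = (D ^ 2 / x) ^ 2 + 2 * D ^ 2 + x ^ 2 := by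
      field_simp
      ring
    rw [this]
    nlinarith [sq_nonneg (D ^ 2 / x), sq_nonneg D]

/-- If three hyperbola profiles satisfy the triangle inequality then their centres are
subadditive. -/
lemma centre_le_of_sqrt_triangle {a b c A B C : ℝ}
    (h : ∀ x y, Real.sqrt ((x + y - c) ^ 2 + C ^ 2) ≤
      Real.sqrt ((x - a) ^ 2 + A ^ 2) + Real.sqrt ((y - b) ^ 2 + B ^ 2)) : a + b ≤ c := by
  have h1 := (tendsto_sqrt_sq_add_sub A).comp
    (tendsto_atTop_add_const_right atTop (-a) tendsto_id)
  have h2 := (tendsto_sqrt_sq_add_sub B).comp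
    (tendsto_atTop_add_const_right atTop (-b) tendsto_id)
  have h3 := h1.add h2
  rw [add_zero] at h3
  have h4 : a + b - c ≤ 0 := by
    refine ge_of_tendsto h3 (Eventually.of_forall fun x => ?_)
    have h5 := h x x
    have h6 : x + x - c ≤ Real.sqrt ((x + x - c) ^ 2 + C ^ 2) :=
      Real.le_sqrt_of_sq_le (by nlinarith [sq_nonneg C])
    simp only [Function.comp, id, ← sub_eq_add_neg]
    linarith
  linarith

lemma centre_add_of_sqrt_triangle {a b c A B C : ℝ}
    (h : ∀ x y, Real.sqrt ((x + y - c) ^ 2 + C ^ 2) ≤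
      Real.sqrt ((x - a) ^ 2 + A ^ 2) + Real.sqrt ((y - b) ^ 2 + B ^ 2)) : c = a + b := by
  apply le_antisymm _ (centre_le_of_sqrt_triangle h)
  have : -a + -b ≤ -c := by
    refine centre_le_of_sqrt_triangle (A := A) (B := B) (C := C) fun x y => ?_
    have := h (-x) (-y)
    rwa [show (-x + -y - c) ^ 2 = (x + y - -c) ^ 2 by ring,
      show (-x - a) ^ 2 = (x - -a) ^ 2 by ring, show (-y - b) ^ 2 = (y - -b) ^ 2 by ring] at this
  linarith

/-- Rays pointing to `ξ` can be synchronised so that, at infinity, the distances between them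
are those of a product with a line. -/
lemma exists_synchronisation {r₀ : ℝ → X} (hr₀ : IsGeodesicRay r₀) :
    ∃ b : {r : ℝ → X // IsGeodesicRay r ∧ Asymptotic r r₀} → ℝ,
      ∀ (r r' : {r : ℝ → X // IsGeodesicRay r ∧ Asymptotic r r₀}) (s s' : ℝ),
      Tendsto (fun t => dist (r.1 (t + (s + b r))) (r'.1 (t + (s' + b r')))) atTop
        (𝓝 (Real.sqrt ((s - s') ^ 2 + transDist r.1 r'.1 ^ 2))) := by
  choose b hb using fun r : {r : ℝ → X // IsGeodesicRay r ∧ Asymptotic r r₀} =>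
    exists_flat_asymptotics r.2.1 hr₀ r.2.2
  refine ⟨b, fun r r' s s' => ?_⟩
  obtain ⟨c, hc⟩ := exists_flat_asymptotics r.2.1 r'.2.1 (r.2.2.trans r'.2.2.symm)
  have hsum : b r = c + b r' := by
    refine centre_add_of_sqrt_triangle (A := transDist r.1 r'.1) (B := transDist r'.1 r₀)
      (C := transDist r.1 r₀) fun x y => ?_
    have h1 := hb r (x + y) 0
    have h2 := hc (x + y) y
    have h3 := hb r' y 0
    rw [sub_zero] at h1 h3
    rw [add_sub_cancel_right] at h2
    exact le_of_tendsto_of_tendsto' h1 (h2.add h3) fun t => dist_triangle _ _ _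
  have := hc (s + b r) (s' + b r')
  rwa [show s + b r - (s' + b r') - c = s - s' by rw [hsum]; ring] at this

variable [ProperSpace X] {T : Type*} [MetricSpace T]

/-- The product of a line with the transverse space of a radial limit point embeds. -/
lemma exists_product_embedding
    (r₀ : ℝ → X) (hr₀ : IsGeodesicRay r₀) (g : ℕ → X ≃ᵢ X)
    (hrad₁ : ∃ M : ℝ, ∀ n : ℕ, ∃ t : ℝ, 0 ≤ t ∧ dist ((g n).symm (r₀ 0)) (r₀ t) ≤ M)
    (hrad₂ : Tendsto (fun n => dist (r₀ 0) ((g n).symm (r₀ 0))) atTop atTop)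
    (q : {r : ℝ → X // IsGeodesicRay r ∧ Asymptotic r r₀} → T)
    (hq : DenseRange q) (hqd : ∀ r r', dist (q r) (q r') = transDist r.1 r'.1) :
    ∃ f : ℝ × T → X, ∀ a b : ℝ × T,
        dist (f a) (f b) ^ 2 = (a.1 - b.1) ^ 2 + dist a.2 b.2 ^ 2 := by
  obtain ⟨M, hM⟩ := hrad₁
  choose t ht0 htM using hM
  have htlim : Tendsto t atTop atTop := by
    refine tendsto_atTop_mono (f := fun n => dist (r₀ 0) ((g n).symm (r₀ 0)) - M) (fun n => ?_)
      (tendsto_atTop_add_const_right _ (-M) hrad₂)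
    have h1 := dist_triangle (r₀ 0) (r₀ (t n)) ((g n).symm (r₀ 0))
    rw [hr₀ 0 (t n) le_rfl (ht0 n), zero_sub, abs_neg, abs_of_nonneg (ht0 n),
      dist_comm (r₀ (t n))] at h1
    linarith [htM n]
  obtain ⟨b, hb⟩ := exists_synchronisation hr₀
  have hb' := fun r r' s s' => ((hb r r' s s').comp htlim).mono_left Nat.hyperfilter_le_atTop
  let ρ : {r : ℝ → X // IsGeodesicRay r ∧ Asymptotic r r₀} :=
    ⟨r₀, hr₀, 0, fun t _ => by rw [dist_self]⟩
  have hex : ∀ (s : ℝ) (r : {r : ℝ → X // IsGeodesicRay r ∧ Asymptotic r r₀}),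
      ∃ y, Tendsto (fun n => g n (r.1 (t n + (s + b r)))) (hyperfilter ℕ : Filter ℕ) (𝓝 y) := by
    intro s r
    have h1 := hb' r ρ s (-b ρ)
    refine exists_ultralimit _ (r₀ 0) (Real.sqrt ((s - -b ρ) ^ 2 + transDist r.1 ρ.1 ^ 2) + 1 + M) ?_
    filter_upwards [h1.eventually_le_const (lt_add_one _)] with n hn
    simp only [Function.comp, ρ, neg_add_cancel, add_zero] at hn
    have h2 := dist_triangle (r.1 (t n + (s + b r))) (r₀ (t n)) ((g n).symm (r₀ 0))
    rw [← (g n).dist_eq, (g n).apply_symm_apply, dist_comm (r₀ (t n))] at h2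
    exact h2.trans (add_le_add hn (htM n))
  choose F hF using hex
  have hFd : ∀ s s' r r', dist (F s r) (F s' r') =
      Real.sqrt ((s - s') ^ 2 + dist (q r) (q r') ^ 2) := by
    intro s s' r r'
    rw [hqd]
    refine tendsto_nhds_unique ((hF s r).dist (hF s' r')) ((hb' r r' s s').congr fun n => ?_)
    rw [(g n).dist_eq]
    rfl
  have hseq : ∀ x : T, ∃ u : ℕ → {r : ℝ → X // IsGeodesicRay r ∧ Asymptotic r r₀},
      Tendsto (fun n => q (u n)) atTop (𝓝 x) := by
    intro x
    obtain ⟨y, hy1, hy2⟩ := mem_closure_iff_seq_limit.mp (hq x)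
    choose u hu using hy1
    exact ⟨u, by simpa only [hu] using hy2⟩
  choose u hu using hseq
  have hlim : ∀ (s : ℝ) (x : T), ∃ y, Tendsto (fun n => F s (u x n)) atTop (𝓝 y) := by
    intro s x
    apply cauchySeq_tendsto_of_complete
    have h1 := (hu x).cauchySeq
    rw [Metric.cauchySeq_iff] at h1 ⊢
    intro ε hε
    obtain ⟨N, hN⟩ := h1 ε hε
    refine ⟨N, fun m hm n hn => ?_⟩
    rw [hFd, sub_self, zero_pow two_ne_zero, zero_add, Real.sqrt_sq dist_nonneg]
    exact hN m hm n hn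
  choose f hf using hlim
  refine ⟨fun a => f a.1 a.2, fun a c => ?_⟩
  refine tendsto_nhds_unique (((hf a.1 a.2).dist (hf c.1 c.2)).pow 2)
    (((((hu a.2).dist (hu c.2)).pow 2).const_add _).congr fun n => ?_)
  rw [hFd, Real.sq_sqrt (by positivity)]

end AsymptoticRays

section TransverseSpace

variable {X T : Type*} [MetricSpace X] [MetricSpace T]

/-- A slice of a product embedding. -/
lemma isometry_slice {f : ℝ × T → X}
    (hf : ∀ a b : ℝ × T, dist (f a) (f b) ^ 2 = (a.1 - b.1) ^ 2 + dist a.2 b.2 ^ 2) (s : ℝ) :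
    Isometry fun x => f (s, x) :=
  Isometry.of_dist_eq fun x y => by
    have := hf (s, x) (s, y)
    rwa [sub_self, zero_pow two_ne_zero, zero_add, sq_eq_sq₀ dist_nonneg dist_nonneg] at this

lemma Isometry.properSpace_of_complete [ProperSpace X] [CompleteSpace T] {i : T → X}
    (hi : Isometry i) : ProperSpace T := by
  refine ⟨fun x r => ?_⟩
  have := hi.isClosedEmbedding.isCompact_preimage (isCompact_closedBall (i x) r)
  rwa [hi.preimage_closedBall] at this

lemma CAT0Space.of_isometry [CAT0Space X] {i : T → X} (hi : Isometry i)
    (hm : ∀ a b : T, ∃ m, IsMidpoint m a b) : CAT0Space T := by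
  refine ⟨hm, fun x a b m h => ?_⟩
  have : IsMidpoint (i m) (i a) (i b) := by
    simpa only [IsMidpoint, hi.dist_eq] using h
  simpa only [hi.dist_eq] using CAT0Space.cn_ineq (i x) _ _ _ this

lemma transDist_le {r r' : ℝ → X} {t t' : ℝ} (ht : 0 ≤ t) (ht' : 0 ≤ t') :
    transDist r r' ≤ dist (r t) (r' t') :=
  csInf_le ⟨0, by rintro _ ⟨_, _, _, _, rfl⟩; exact dist_nonneg⟩ ⟨_, _, ht, ht', rfl⟩

lemma exists_midpoint_of_forall_approx [ProperSpace T] {a b : T}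
    (h : ∀ ε > 0, ∃ m, dist a m ≤ dist a b / 2 + ε ∧ dist b m ≤ dist a b / 2 + ε) :
    ∃ m, IsMidpoint m a b := by
  choose m hm1 hm2 using fun n : ℕ => h (1 / ((n : ℝ) + 1)) Nat.one_div_pos_of_nat
  have hε : Tendsto (fun n : ℕ => dist a b / 2 + 1 / ((n : ℝ) + 1)) (hyperfilter ℕ : Filter ℕ)
      (𝓝 (dist a b / 2)) := by
    simpa using (tendsto_one_div_add_atTop_nhds_zero_nat (𝕜 := ℝ)).const_add (dist a b / 2)
      |>.mono_left Nat.hyperfilter_le_atTop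
  obtain ⟨y, hy⟩ := exists_ultralimit (hyperfilter ℕ) (x := m) a (dist a b / 2 + 1)
    (Eventually.of_forall fun n => by
      rw [dist_comm]
      refine (hm1 n).trans ?_
      gcongr
      exact (div_le_one (by positivity)).mpr (by linarith [n.cast_nonneg (α := ℝ)]))
  have h1 : dist a y ≤ dist a b / 2 :=
    le_of_tendsto_of_tendsto' (tendsto_const_nhds.dist hy) hε hm1
  have h2 : dist b y ≤ dist a b / 2 :=
    le_of_tendsto_of_tendsto' (tendsto_const_nhds.dist hy) hε hm2
  have h3 := dist_triangle_right a b y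
  exact ⟨y, by linarith, by linarith⟩

lemma exists_midpoint_transverse [ProperSpace X] [CAT0Space X] [ProperSpace T]
    {r₀ : ℝ → X} (q : {r : ℝ → X // IsGeodesicRay r ∧ Asymptotic r r₀} → T)
    (hq : DenseRange q) (hqd : ∀ r r', dist (q r) (q r') = transDist r.1 r'.1) (a b : T) :
    ∃ m, IsMidpoint m a b := by
  refine exists_midpoint_of_forall_approx fun ε hε => ?_
  obtain ⟨r, hr⟩ := hq.exists_dist_lt a (ε := ε / 4) (by positivity)
  obtain ⟨r', hr'⟩ := hq.exists_dist_lt b (ε := ε / 4) (by positivity)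
  have hlt : transDist r.1 r'.1 < transDist r.1 r'.1 + ε / 2 := by linarith
  obtain ⟨_, ⟨t, t', ht, ht', rfl⟩, hd⟩ := exists_lt_of_csInf_lt
    (by exact ⟨_, 0, 0, le_rfl, le_rfl, rfl⟩) hlt
  obtain ⟨m, hm⟩ := CAT0Space.midpoint_exists (r.1 t) (r'.1 t')
  obtain ⟨w, hw, hw0, hwr⟩ := exists_asymptotic_ray r.2.1 m
  let w' : {r : ℝ → X // IsGeodesicRay r ∧ Asymptotic r r₀} :=
    ⟨w, hw, Asymptotic.trans ⟨_, hwr⟩ r.2.2⟩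
  have h1 : dist (q r) (q w') ≤ dist (r.1 t) (r'.1 t') / 2 := by
    rw [hqd, ← hm.1, ← hw0]
    exact transDist_le ht le_rfl
  have h2 : dist (q r') (q w') ≤ dist (r.1 t) (r'.1 t') / 2 := by
    rw [hqd, ← hm.2, ← hw0]
    exact transDist_le ht' le_rfl
  have h3 : transDist r.1 r'.1 ≤ dist a b + ε / 2 := by
    rw [← hqd]
    have h4 := dist_triangle4 (q r) a b (q r')
    rw [dist_comm (q r) a] at h4
    linarith
  have h5 := dist_triangle a (q r) (q w')
  have h6 := dist_triangle b (q r') (q w')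
  exact ⟨q w', by linarith, by linarith⟩

end TransverseSpace

lemma le_of_forall_pos_mul_le {a b K : ℝ} (h : ∀ l : ℝ, 0 < l → l * a ≤ l * b + K) : a ≤ b := by
  by_contra! hab
  have h1 := h ((|K| + 1) / (a - b)) (div_pos (by positivity) (sub_pos.mpr hab))
  have h2 : (|K| + 1) / (a - b) * (a - b) = |K| + 1 :=
    div_mul_cancel₀ _ (sub_pos.mpr hab).ne'
  linarith [le_abs_self K]

/-- A metric cone: a metric space with dilations about an apex. -/
class MetricCone (C : Type*) [MetricSpace C] where
  /-- the apex -/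
  apex : C
  /-- dilations (only meaningful for nonnegative factors) -/
  scale : ℝ → C → C
  scale_one : ∀ x, scale 1 x = x
  scale_zero : ∀ x, scale 0 x = apex
  scale_scale : ∀ {s t : ℝ}, 0 ≤ s → 0 ≤ t → ∀ x, scale s (scale t x) = scale (s * t) x
  dist_scale : ∀ {s : ℝ}, 0 ≤ s → ∀ x y, dist (scale s x) (scale s y) = s * dist x y
  dist_scale_self : ∀ {s t : ℝ}, 0 ≤ s → 0 ≤ t → ∀ x,
    dist (scale s x) (scale t x) = |s - t| * dist apex x

/-- The space of constant speed rays from `t₀`, extended by `t₀` to negative times. For a proper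
CAT(0) space it is the Euclidean cone over the Tits boundary. -/
@[ext]
structure RayCone {T : Type*} [MetricSpace T] (t₀ : T) where
  /-- the parametrisation -/
  toFun : ℝ → T
  prop : (∀ t ≤ 0, toFun t = t₀) ∧ ∃ v, 0 ≤ v ∧ HasSpeedOn toFun v (Ici 0)

namespace RayCone

variable {T : Type*} [MetricSpace T] {t₀ : T}

/-- The speed of a constant speed ray. -/
noncomputable def speed (c : RayCone t₀) : ℝ := dist (c.1 0) (c.1 1)

lemma speed_nonneg (c : RayCone t₀) : 0 ≤ c.speed := dist_nonneg

lemma apply_zero (c : RayCone t₀) : c.1 0 = t₀ := c.2.1 0 le_rfl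

lemma hasSpeedOn (c : RayCone t₀) : HasSpeedOn c.1 c.speed (Ici 0) := by
  obtain ⟨v, hv, h⟩ := c.2.2
  have : c.speed = v := by
    rw [speed, h 0 (mem_Ici.mpr le_rfl) 1 (mem_Ici.mpr zero_le_one)]
    simp
  rwa [this]

lemma dist_base (c : RayCone t₀) {t : ℝ} (ht : 0 ≤ t) : dist t₀ (c.1 t) = c.speed * t := by
  have := c.hasSpeedOn 0 (mem_Ici.mpr le_rfl) t ht
  rwa [c.apply_zero, zero_sub, abs_neg, abs_of_nonneg ht] at this

/-- The cone point given by a constant speed parametrisation. -/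
def ofRay (c : ℝ → T) (h0 : c 0 = t₀) {v : ℝ} (hv : 0 ≤ v) (hc : HasSpeedOn c v (Ici 0)) :
    RayCone t₀ :=
  ⟨fun t => c (max t 0), fun t ht => by simp [max_eq_right ht, h0], v, hv, fun s hs t ht => by
    have hs : 0 ≤ s := hs
    have ht : 0 ≤ t := ht
    simpa [max_eq_left hs, max_eq_left ht] using hc s hs t ht⟩

lemma ofRay_apply (c : ℝ → T) (h0 : c 0 = t₀) {v : ℝ} (hv : 0 ≤ v) (hc : HasSpeedOn c v (Ici 0))
    {t : ℝ} (ht : 0 ≤ t) : (ofRay c h0 hv hc).1 t = c t := by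
  simp [ofRay, max_eq_left ht]

lemma speed_ofRay (c : ℝ → T) (h0 : c 0 = t₀) {v : ℝ} (hv : 0 ≤ v) (hc : HasSpeedOn c v (Ici 0)) :
    (ofRay c h0 hv hc).speed = v := by
  rw [speed, ofRay_apply _ _ _ _ le_rfl, ofRay_apply _ _ _ _ zero_le_one,
    hc 0 (mem_Ici.mpr le_rfl) 1 (mem_Ici.mpr zero_le_one)]
  simp

lemma ext_nonneg {c c' : RayCone t₀} (h : ∀ t, 0 < t → c.1 t = c'.1 t) : c = c' := by
  apply RayCone.ext
  funext t
  rcases lt_or_ge 0 t with ht | ht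
  · exact h t ht
  · rw [c.2.1 t ht, c'.2.1 t ht]

lemma ratio_le (c c' : RayCone t₀) (t : ℝ) :
    dist (c.1 t) (c'.1 t) / t ≤ c.speed + c'.speed := by
  rcases lt_or_ge 0 t with ht | ht
  · rw [div_le_iff₀ ht]
    have := dist_triangle_left (c.1 t) (c'.1 t) t₀
    rw [c.dist_base ht.le, c'.dist_base ht.le] at this
    linarith
  · rw [c.2.1 t ht, c'.2.1 t ht, dist_self, zero_div]
    exact add_nonneg c.speed_nonneg c'.speed_nonneg

noncomputable instance : Dist (RayCone t₀) :=
  ⟨fun c c' => ⨆ t : ℝ, dist (c.1 t) (c'.1 t) / t⟩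

lemma dist_def (c c' : RayCone t₀) : dist c c' = ⨆ t : ℝ, dist (c.1 t) (c'.1 t) / t := rfl

lemma bddAbove_ratio (c c' : RayCone t₀) :
    BddAbove (range fun t : ℝ => dist (c.1 t) (c'.1 t) / t) :=
  ⟨_, by rintro _ ⟨t, rfl⟩; exact ratio_le c c' t⟩

lemma dist_apply_le (c c' : RayCone t₀) {t : ℝ} (ht : 0 ≤ t) :
    dist (c.1 t) (c'.1 t) ≤ t * dist c c' := by
  rcases ht.eq_or_lt with rfl | ht
  · rw [c.apply_zero, c'.apply_zero, dist_self, zero_mul]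
  · rw [mul_comm, ← div_le_iff₀ ht]
    exact le_ciSup (bddAbove_ratio c c') t

lemma dist_le_of_forall {c c' : RayCone t₀} {R : ℝ} (hR : 0 ≤ R)
    (h : ∀ t, 0 < t → dist (c.1 t) (c'.1 t) ≤ t * R) : dist c c' ≤ R := by
  refine ciSup_le fun t => ?_
  rcases lt_or_ge 0 t with ht | ht
  · rw [div_le_iff₀ ht, mul_comm]
    exact h t ht
  · rwa [c.2.1 t ht, c'.2.1 t ht, dist_self, zero_div]

/-- Scaling of cone points, by a factor that is nonnegative. -/
def dilate (s : ℝ) (c : RayCone t₀) : RayCone t₀ :=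
  ⟨fun t => c.1 (max s 0 * t), fun t ht =>
    c.2.1 _ (mul_nonpos_of_nonneg_of_nonpos (le_max_right _ _) ht), max s 0 * c.speed,
    mul_nonneg (le_max_right _ _) c.speed_nonneg, fun t ht u hu => by
      have hs : 0 ≤ max s 0 := le_max_right _ _
      rw [c.hasSpeedOn _ (mul_nonneg hs ht) _ (mul_nonneg hs hu), ← mul_sub, abs_mul,
        abs_of_nonneg hs]
      ring⟩

lemma dilate_apply {s : ℝ} (hs : 0 ≤ s) (c : RayCone t₀) (t : ℝ) :
    (dilate s c).1 t = c.1 (s * t) := by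
  simp [dilate, max_eq_left hs]

variable [CAT0Space T]

lemma ratio_mono (c c' : RayCone t₀) : Monotone fun t : ℝ => dist (c.1 t) (c'.1 t) / t := by
  intro s t hst
  simp only
  rcases lt_or_ge 0 s with hs | hs
  · have ht := hs.trans_le hst
    have h := HasSpeedOn.dist_le_chord ht (c.hasSpeedOn.mono Icc_subset_Ici_self)
      (c'.hasSpeedOn.mono Icc_subset_Ici_self) ⟨hs.le, hst⟩
    rw [c.apply_zero, c'.apply_zero, dist_self, mul_zero, zero_add] at h
    rw [div_le_div_iff₀ hs ht]
    calc dist (c.1 s) (c'.1 s) * t ≤ s / t * dist (c.1 t) (c'.1 t) * t := by gcongr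
      _ = dist (c.1 t) (c'.1 t) * s := by field_simp
  · rw [c.2.1 s hs, c'.2.1 s hs, dist_self, zero_div]
    rcases lt_or_ge 0 t with ht | ht
    · positivity
    · rw [c.2.1 t ht, c'.2.1 t ht, dist_self, zero_div]

lemma tendsto_ratio (c c' : RayCone t₀) :
    Tendsto (fun t : ℝ => dist (c.1 t) (c'.1 t) / t) atTop (𝓝 (dist c c')) :=
  tendsto_atTop_ciSup (ratio_mono c c') (bddAbove_ratio c c')

noncomputable instance : MetricSpace (RayCone t₀) where
  dist_self c := by simp [dist_def]
  dist_comm c c' := by simp only [dist_def, dist_comm]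
  dist_triangle c c' c'' := by
    refine le_of_tendsto_of_tendsto (tendsto_ratio c c'')
      ((tendsto_ratio c c').add (tendsto_ratio c' c'')) ?_
    filter_upwards [eventually_gt_atTop 0] with t ht
    rw [← add_div]
    gcongr
    exact dist_triangle _ _ _
  eq_of_dist_eq_zero {c c'} h := ext_nonneg fun t ht => by
    have := dist_apply_le c c' ht.le
    rw [h, mul_zero] at this
    exact dist_le_zero.mp this

/-- The constant ray. -/
def const (t₀ : T) : RayCone t₀ := ⟨fun _ => t₀, fun _ _ => rfl, 0, le_rfl, fun s _ t _ => by simp⟩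

lemma dist_eq_of_forall {c c' : RayCone t₀} {R : ℝ}
    (h : ∀ t, 0 < t → dist (c.1 t) (c'.1 t) = t * R) : dist c c' = R := by
  refine tendsto_nhds_unique (tendsto_ratio c c') (tendsto_const_nhds.congr' ?_)
  filter_upwards [eventually_gt_atTop 0] with t ht
  rw [h t ht]
  field_simp

lemma dist_const (c : RayCone t₀) : dist (const t₀) c = c.speed :=
  dist_eq_of_forall fun t ht => by
    rw [mul_comm]
    exact c.dist_base ht.le

noncomputable instance : MetricCone (RayCone t₀) where
  apex := const t₀
  scale := dilate
  scale_one c := ext_nonneg fun t _ => by rw [dilate_apply zero_le_one, one_mul]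
  scale_zero c := ext_nonneg fun t _ => by
    rw [dilate_apply le_rfl, zero_mul, c.apply_zero]
    rfl
  scale_scale {s t} hs ht c := ext_nonneg fun u _ => by
    rw [dilate_apply hs, dilate_apply ht, dilate_apply (mul_nonneg hs ht)]
    ring_nf
  dist_scale {s} hs c c' := by
    rcases hs.eq_or_lt with rfl | hs'
    · rw [zero_mul]
      exact dist_eq_of_forall fun t ht => by
        rw [dilate_apply le_rfl, dilate_apply le_rfl, zero_mul, c.apply_zero, c'.apply_zero]
        simp
    · refine tendsto_nhds_unique (tendsto_ratio _ _)
        ((((tendsto_ratio c c').comp (tendsto_id.const_mul_atTop hs')).const_mul s).congr' ?_)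
      filter_upwards [eventually_gt_atTop 0] with t ht
      simp only [Function.comp, id]
      rw [dilate_apply hs, dilate_apply hs]
      field_simp
  dist_scale_self {s t} hs ht c := dist_eq_of_forall fun u hu => by
    rw [dilate_apply hs, dilate_apply ht, c.hasSpeedOn _ (mul_nonneg hs hu.le) _
      (mul_nonneg ht hu.le), ← sub_mul, abs_mul, abs_of_pos hu, dist_const]
    ring

variable [ProperSpace T]

instance : CompleteSpace (RayCone t₀) := by
  refine Metric.complete_of_cauchySeq_tendsto fun c hc => ?_
  have hpt : ∀ t, ∃ y, Tendsto (fun n => (c n).1 t) atTop (𝓝 y) := by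
    intro t
    rcases lt_or_ge 0 t with ht | ht
    · apply cauchySeq_tendsto_of_complete
      rw [Metric.cauchySeq_iff] at hc ⊢
      intro ε hε
      obtain ⟨N, hN⟩ := hc (ε / t) (by positivity)
      refine ⟨N, fun m hm n hn => (dist_apply_le _ _ ht.le).trans_lt ?_⟩
      rw [mul_comm, ← lt_div_iff₀ ht]
      exact hN m hm n hn
    · exact ⟨t₀, tendsto_const_nhds.congr fun n => ((c n).2.1 t ht).symm⟩
  choose y hy using hpt
  have hy0 : ∀ t ≤ 0, y t = t₀ := fun t ht =>
    tendsto_nhds_unique (hy t) (tendsto_const_nhds.congr fun n => ((c n).2.1 t ht).symm)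
  have hsp : Tendsto (fun n => (c n).speed) atTop (𝓝 (dist (y 0) (y 1))) := (hy 0).dist (hy 1)
  refine ⟨⟨y, hy0, dist (y 0) (y 1), dist_nonneg, fun s hs t ht => ?_⟩, ?_⟩
  · exact tendsto_nhds_unique ((hy s).dist (hy t))
      ((hsp.mul_const |s - t|).congr fun n => ((c n).hasSpeedOn s hs t ht).symm)
  · rw [Metric.tendsto_atTop]
    rw [Metric.cauchySeq_iff] at hc
    intro ε hε
    obtain ⟨N, hN⟩ := hc (ε / 2) (by positivity)
    refine ⟨N, fun n hn => (dist_le_of_forall (by positivity) fun t ht => ?_).trans_lt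
      (half_lt_self hε)⟩
    refine le_of_tendsto (tendsto_const_nhds.dist (hy t)) ?_
    filter_upwards [eventually_ge_atTop N] with m hm
    refine (dist_apply_le _ _ ht.le).trans ?_
    gcongr
    exact (hN n hn m hm).le

instance : CAT0Space (RayCone t₀) := by
  refine CAT0Space.of_exists_cn fun a b => ?_
  choose m hm using fun n : ℕ => CAT0Space.midpoint_exists (a.1 n) (b.1 n)
  have hbd : ∀ n : ℕ, dist t₀ (m n) / n ≤ 2 * (a.speed + b.speed) := by
    intro n
    rcases n.eq_zero_or_pos with rfl | hn
    · simpa using add_nonneg a.speed_nonneg b.speed_nonneg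
    · have hn : (0 : ℝ) < n := by exact_mod_cast hn
      rw [div_le_iff₀ hn]
      have h1 := dist_triangle t₀ (a.1 n) (m n)
      rw [(hm n).1, a.dist_base hn.le] at h1
      have h2 := ratio_le a b n
      rw [div_le_iff₀ hn] at h2
      nlinarith [a.speed_nonneg, b.speed_nonneg]
  obtain ⟨v, hv⟩ := exists_ultralimit (hyperfilter ℕ) (x := fun n : ℕ => dist t₀ (m n) / n) 0
    (2 * (a.speed + b.speed)) (Eventually.of_forall fun n => by
      rw [Real.dist_eq, sub_zero, abs_of_nonneg (by positivity)]
      exact hbd n)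
  have hv0 : 0 ≤ v := ge_of_tendsto' hv fun n => by positivity
  obtain ⟨c, hc0, hc, hcw⟩ := exists_limit_ray t₀ m hv
  refine ⟨ofRay c hc0 hv0 hc, fun x => ?_⟩
  have hR : 0 ≤ (dist x a ^ 2 + dist x b ^ 2) / 2 - dist a b ^ 2 / 4 := by
    have h1 := dist_triangle_left a b x
    nlinarith [sq_nonneg (dist x a - dist x b), dist_nonneg (x := a) (y := b)]
  rw [← Real.sq_sqrt hR, dist_comm]
  gcongr
  refine dist_le_of_forall (Real.sqrt_nonneg _) fun t ht => ?_
  rw [ofRay_apply _ _ _ _ ht.le]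
  have hlim := fun x y : RayCone t₀ => ((tendsto_ratio x y).comp
    (tendsto_natCast_atTop_atTop (R := ℝ))).mono_left Nat.hyperfilter_le_atTop
  refine hcw x.1 x.speed x.hasSpeedOn t ht.le
    (fun n => t * Real.sqrt (((dist (x.1 n) (a.1 n) / n) ^ 2 + (dist (x.1 n) (b.1 n) / n) ^ 2) / 2
      - (dist (a.1 n) (b.1 n) / n) ^ 2 / 4)) _ ?_ ?_
  · exact ((((((hlim x a).pow 2).add ((hlim x b).pow 2)).div_const 2).sub
      (((hlim a b).pow 2).div_const 4)).sqrt).const_mul t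
  · filter_upwards [Nat.hyperfilter_le_atTop (eventually_gt_atTop 0)] with n hn
    have hn : (0 : ℝ) < n := by exact_mod_cast hn
    rw [x.apply_zero, dist_self, mul_zero, zero_add, div_mul_eq_mul_div, mul_div_assoc]
    gcongr
    apply Real.le_sqrt_of_sq_le
    have := CAT0Space.cn_ineq (x.1 n) _ _ _ (hm n)
    rw [dist_comm (m n), div_pow, div_pow, div_pow, div_pow, ← add_div, div_div, div_div,
      mul_comm _ (2 : ℝ), mul_comm _ (4 : ℝ), ← div_div, ← div_div, ← sub_div]
    gcongr

end RayCone

namespace MetricCone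

variable {C : Type*} [MetricSpace C] [MetricCone C]

/-- The distance to the apex. -/
noncomputable def nrm (x : C) : ℝ := dist (apex : C) x

/-- The scalar product in a metric cone. -/
noncomputable def ip (x y : C) : ℝ := (nrm x ^ 2 + nrm y ^ 2 - dist x y ^ 2) / 2

lemma nrm_nonneg (x : C) : 0 ≤ nrm x := dist_nonneg

lemma continuous_nrm : Continuous (nrm : C → ℝ) := by
  unfold nrm
  fun_prop

lemma continuous_ip_left (z : C) : Continuous fun x => ip x z := by
  unfold ip
  have := continuous_nrm (C := C)
  fun_prop

lemma scale_apex {s : ℝ} (hs : 0 ≤ s) : scale s (apex : C) = apex := by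
  rw [← scale_zero (apex : C), scale_scale hs le_rfl, mul_zero]

lemma nrm_scale {s : ℝ} (hs : 0 ≤ s) (x : C) : nrm (scale s x) = s * nrm x := by
  unfold nrm
  conv_lhs => rw [← scale_apex (C := C) hs]
  rw [dist_scale hs]

lemma nrm_apex : nrm (apex : C) = 0 := dist_self _

lemma ip_comm (x y : C) : ip x y = ip y x := by
  unfold ip
  rw [dist_comm]
  ring

lemma ip_apex_left (y : C) : ip apex y = 0 := by
  unfold ip
  rw [nrm_apex]
  simp [nrm]

lemma ip_scale_scale {s : ℝ} (hs : 0 ≤ s) (x y : C) :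
    ip (scale s x) (scale s y) = s ^ 2 * ip x y := by
  unfold ip
  rw [nrm_scale hs, nrm_scale hs, dist_scale hs]
  ring

lemma ip_le (x y : C) : ip x y ≤ nrm x * nrm y := by
  have h := abs_dist_sub_le x y (apex : C)
  have h2 := abs_le.mp h
  have : (nrm x - nrm y) ^ 2 ≤ dist x y ^ 2 := by
    rw [sq_le_sq, abs_of_nonneg (dist_nonneg (x := x) (y := y))]
    simpa only [nrm, dist_comm] using h
  unfold ip
  nlinarith

lemma continuous_coords {ι : Type*} (z : ι → C) (w : Finset ι) :
    Continuous fun (y : C) (i : w) => ip y (z i) :=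
  continuous_pi fun i => continuous_ip_left (z i)

/-- The concave functional whose maximiser is the barycentre of the points `z i` with weights
`α i`. -/
noncomputable def potential {ι : Type*} [Fintype ι] (z : ι → C) (α : ι → ℝ) (x : C) : ℝ :=
  ∑ i, α i * ip x (z i) - nrm x ^ 2 / 2

lemma continuous_potential {ι : Type*} [Fintype ι] (z : ι → C) (α : ι → ℝ) :
    Continuous (potential z α) := by
  unfold potential
  have := continuous_nrm (C := C)
  have := fun i => continuous_ip_left (z i)
  fun_prop

lemma bddAbove_potential {ι : Type*} [Fintype ι] (z : ι → C) {α : ι → ℝ}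
    (hα : ∀ i, 0 ≤ α i) : BddAbove (range (potential z α)) := by
  refine ⟨(∑ i, α i * nrm (z i)) ^ 2 / 2, ?_⟩
  rintro _ ⟨x, rfl⟩
  have : ∑ i, α i * ip x (z i) ≤ nrm x * ∑ i, α i * nrm (z i) := by
    rw [Finset.mul_sum]
    refine Finset.sum_le_sum fun i _ => ?_
    rw [mul_left_comm]
    exact mul_le_mul_of_nonneg_left (ip_le _ _) (hα i)
  unfold potential
  nlinarith [sq_nonneg (nrm x - ∑ i, α i * nrm (z i))]

variable [CAT0Space C]

lemma ip_scale_ge {l : ℝ} (hl : 0 ≤ l) (hl1 : l ≤ 1) (x y : C) : l * ip x y ≤ ip (scale l x) y := by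
  have hs : HasSpeedOn (fun t => scale t x) (nrm x) (Icc 0 1) := fun s hs t ht => by
    rw [dist_scale_self hs.1 ht.1, mul_comm]
    rfl
  have h := hs.stewart one_pos y ⟨hl, hl1⟩
  simp only [scale_one, scale_zero, div_one] at h
  rw [dist_comm y apex, dist_comm y x, dist_comm y] at h
  unfold ip
  rw [nrm_scale hl]
  change _ ≤ (1 - l) * nrm y ^ 2 + _ - _ at h
  nlinarith

lemma ip_scale_left_aux {l : ℝ} (hl : 0 < l) (hl1 : l ≤ 1) (x y : C) :
    ip (scale l x) y = l * ip x y := by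
  refine le_antisymm ?_ (ip_scale_ge hl.le hl1 x y)
  have h1 : scale l (scale l⁻¹ y) = y := by
    rw [scale_scale hl.le (inv_pos.mpr hl).le, mul_inv_cancel₀ hl.ne', scale_one]
  have h2 := ip_scale_ge hl.le hl1 (scale l⁻¹ y) x
  rw [h1] at h2
  have h3 := ip_scale_scale hl.le x (scale l⁻¹ y)
  rw [h1] at h3
  rw [h3, ip_comm x y, ip_comm x, sq, mul_assoc]
  gcongr

lemma ip_scale_left {l : ℝ} (hl : 0 ≤ l) (x y : C) : ip (scale l x) y = l * ip x y := by
  rcases hl.eq_or_lt with rfl | hl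
  · rw [scale_zero, ip_apex_left, zero_mul]
  rcases le_total l 1 with h | h
  · exact ip_scale_left_aux hl h x y
  · have h1 := ip_scale_left_aux (inv_pos.mpr hl) (inv_le_one_of_one_le₀ h) (scale l x) y
    rw [scale_scale (inv_pos.mpr hl).le hl.le, inv_mul_cancel₀ hl.ne', scale_one] at h1
    rw [h1]
    field_simp

lemma ip_scale_right {l : ℝ} (hl : 0 ≤ l) (x y : C) : ip x (scale l y) = l * ip x y := by
  rw [ip_comm, ip_scale_left hl, ip_comm]

lemma ip_sub_ip_le (x y z : C) : ip x z - ip y z ≤ dist x y * nrm z := by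
  refine le_of_forall_pos_mul_le
    (K := (nrm x ^ 2 - nrm y ^ 2) / 2 + dist x y * (nrm x + nrm y) / 2) fun l hl => ?_
  rw [mul_sub, ← ip_scale_right hl.le, ← ip_scale_right hl.le]
  set w := scale l z with hw
  have h1 : nrm w = l * nrm z := nrm_scale hl.le z
  have h2 : dist y w - dist x w ≤ dist x y := by
    have := dist_triangle_left y w x
    linarith
  have h3 : dist x w ≤ nrm x + nrm w := dist_triangle_left _ _ _
  have h4 : dist y w ≤ nrm y + nrm w := dist_triangle_left _ _ _
  have h5 : (dist y w - dist x w) * (dist y w + dist x w) ≤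
      dist x y * (dist y w + dist x w) := by gcongr
  have h6 : dist x y * (dist y w + dist x w) ≤ dist x y * (nrm x + nrm y + 2 * nrm w) := by
    exact mul_le_mul_of_nonneg_left (by linarith) dist_nonneg
  unfold ip
  rw [h1] at *
  nlinarith

lemma abs_ip_sub_ip_le (x y z : C) : |ip x z - ip y z| ≤ dist x y * nrm z := by
  rw [abs_le]
  have := ip_sub_ip_le y x z
  rw [dist_comm] at this
  exact ⟨by linarith, ip_sub_ip_le x y z⟩

lemma ip_midpoint {m x y : C} (h : IsMidpoint m x y) (z : C) :
    (ip x z + ip y z) / 2 ≤ ip m z := by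
  refine le_of_forall_pos_mul_le
    (K := (nrm x ^ 2 / 2 + nrm y ^ 2 / 2 - nrm m ^ 2) / 2) fun l hl => ?_
  rw [mul_div_assoc', mul_add, ← ip_scale_right hl.le, ← ip_scale_right hl.le,
    ← ip_scale_right hl.le]
  have := CAT0Space.cn_ineq (scale l z) x y m h
  unfold ip
  rw [dist_comm _ x, dist_comm _ y, dist_comm _ m] at this
  nlinarith [sq_nonneg (dist x y)]

section Barycentre

variable {ι : Type*} [Fintype ι]

lemma potential_midpoint (z : ι → C) {α : ι → ℝ} (hα : ∀ i, 0 ≤ α i) {m x y : C}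
    (h : IsMidpoint m x y) :
    (potential z α x + potential z α y) / 2 + dist x y ^ 2 / 8 ≤ potential z α m := by
  have h1 := CAT0Space.cn_ineq apex x y m h
  have h2 : (∑ i, α i * ip x (z i) + ∑ i, α i * ip y (z i)) / 2 ≤ ∑ i, α i * ip m (z i) := by
    rw [← Finset.sum_add_distrib, Finset.sum_div]
    gcongr with i
    rw [← mul_add, mul_div_assoc]
    exact mul_le_mul_of_nonneg_left (ip_midpoint h _) (hα i)
  change nrm m ^ 2 ≤ (nrm x ^ 2 + nrm y ^ 2) / 2 - _ at h1
  unfold potential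
  linarith

variable [CompleteSpace C]

lemma exists_maximizer (z : ι → C) {α : ι → ℝ} (hα : ∀ i, 0 ≤ α i) :
    ∃ s : C, ∀ x, potential z α x ≤ potential z α s - dist x s ^ 2 / 4 := by
  set h := ⨆ x, potential z α x with hh
  have hle : ∀ x, potential z α x ≤ h := le_ciSup (bddAbove_potential z hα)
  have hd : ∀ x y, dist x y ^ 2 / 8 ≤ h - (potential z α x + potential z α y) / 2 := by
    intro x y
    obtain ⟨m, hm⟩ := CAT0Space.midpoint_exists x y
    linarith [potential_midpoint z hα hm, hle m]
  have : Nonempty C := ⟨apex⟩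
  have hex : ∀ n : ℕ, ∃ x, h - 1 / ((n : ℝ) + 1) < potential z α x := fun n =>
    exists_lt_of_lt_ciSup (sub_lt_self _ Nat.one_div_pos_of_nat)
  choose x hx using hex
  have hc : CauchySeq x := by
    rw [Metric.cauchySeq_iff]
    intro ε hε
    obtain ⟨N, hN⟩ := exists_nat_one_div_lt (show (0 : ℝ) < ε ^ 2 / 8 by positivity)
    have hN' : ∀ n ≥ N, h - ε ^ 2 / 8 < potential z α (x n) := fun n hn => by
      have : 1 / ((n : ℝ) + 1) ≤ 1 / ((N : ℝ) + 1) := Nat.one_div_le_one_div hn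
      linarith [hx n]
    refine ⟨N, fun m hm n hn => ?_⟩
    apply lt_of_pow_lt_pow_left₀ 2 hε.le
    linarith [hd (x m) (x n), hN' m hm, hN' n hn]
  obtain ⟨s, hs⟩ := cauchySeq_tendsto_of_complete hc
  have hsh : potential z α s = h := by
    refine le_antisymm (hle s) ?_
    refine le_of_tendsto_of_tendsto' (b := atTop) (g := fun n => potential z α (x n))
      (f := fun n : ℕ => h - 1 / ((n : ℝ) + 1)) ?_ ?_ fun n => (hx n).le
    · simpa using (tendsto_one_div_add_atTop_nhds_zero_nat (𝕜 := ℝ)).const_sub h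
    · exact ((continuous_potential z α).tendsto s).comp hs
  refine ⟨s, fun y => ?_⟩
  have := hd y s
  rw [hsh] at this ⊢
  linarith

/-- The barycentre of the points `z i` with weights `α i ≥ 0`. -/
noncomputable def bary (z : ι → C) (α : ι → ℝ) : C :=
  open scoped Classical in
  if h : ∀ i, 0 ≤ α i then (exists_maximizer z h).choose else apex

variable (z : ι → C)

lemma potential_le_bary {α : ι → ℝ} (hα : ∀ i, 0 ≤ α i) (x : C) :
    potential z α x ≤ potential z α (bary z α) - dist x (bary z α) ^ 2 / 4 := by
  rw [bary, dif_pos hα]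
  exact (exists_maximizer z hα).choose_spec x

lemma eq_bary {α : ι → ℝ} (hα : ∀ i, 0 ≤ α i) {x : C}
    (hx : potential z α (bary z α) ≤ potential z α x) : x = bary z α := by
  have := potential_le_bary z hα x
  have h0 : dist x (bary z α) ^ 2 ≤ 0 := by linarith
  exact dist_eq_zero.mp (pow_eq_zero_iff two_ne_zero |>.mp (le_antisymm h0 (sq_nonneg _)))

lemma dist_bary_le {α β : ι → ℝ} (hα : ∀ i, 0 ≤ α i) (hβ : ∀ i, 0 ≤ β i) :
    dist (bary z α) (bary z β) ≤ 2 * ∑ i, |α i - β i| * nrm (z i) := by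
  set x := bary z α
  set y := bary z β
  have h1 := potential_le_bary z hα y
  have h2 := potential_le_bary z hβ x
  rw [dist_comm] at h1
  have h3 : dist x y ^ 2 / 2 ≤ ∑ i, (α i - β i) * (ip x (z i) - ip y (z i)) := by
    have : ∑ i, (α i - β i) * (ip x (z i) - ip y (z i)) = potential z α x - potential z α y +
        potential z β y - potential z β x := by
      simp only [potential, sub_mul, mul_sub, Finset.sum_sub_distrib]
      ring
    rw [this]
    linarith
  have h4 : ∑ i, (α i - β i) * (ip x (z i) - ip y (z i)) ≤
      dist x y * ∑ i, |α i - β i| * nrm (z i) := by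
    rw [Finset.mul_sum]
    refine Finset.sum_le_sum fun i _ => ?_
    refine (le_abs_self _).trans ?_
    rw [abs_mul, mul_left_comm]
    gcongr
    exact abs_ip_sub_ip_le _ _ _
  rcases (dist_nonneg (x := x) (y := y)).eq_or_lt with h | h
  · rw [← h]
    exact mul_nonneg zero_le_two (Finset.sum_nonneg fun i _ =>
      mul_nonneg (abs_nonneg _) (nrm_nonneg _))
  · refine le_of_mul_le_mul_left ?_ h
    nlinarith

lemma continuousOn_bary : ContinuousOn (bary z) {α | ∀ i, 0 ≤ α i} := by
  intro α hα
  rw [ContinuousWithinAt, tendsto_iff_dist_tendsto_zero]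
  refine squeeze_zero' (Eventually.of_forall fun _ => dist_nonneg)
    (eventually_mem_nhdsWithin.mono fun β hβ => dist_bary_le z hβ hα) ?_
  have : Continuous fun β : ι → ℝ => 2 * ∑ i, |β i - α i| * nrm (z i) := by fun_prop
  have h := this.tendsto α
  simp only [sub_self, abs_zero, zero_mul, Finset.sum_const_zero, mul_zero] at h
  exact h.mono_left nhdsWithin_le_nhds

lemma sum_mul_ip_bary {α : ι → ℝ} (hα : ∀ i, 0 ≤ α i) :
    ∑ i, α i * ip (bary z α) (z i) = nrm (bary z α) ^ 2 := by
  set x := bary z α with hx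
  set A := ∑ i, α i * ip x (z i) with hA
  have key : ∀ s, 0 ≤ s → s * A - s ^ 2 * nrm x ^ 2 / 2 ≤ A - nrm x ^ 2 / 2 := by
    intro s hs
    have h := potential_le_bary z hα (scale s x)
    rw [← hx] at h
    unfold potential at h
    have h2 : ∑ i, α i * ip (scale s x) (z i) = s * A := by
      rw [hA, Finset.mul_sum]
      exact Finset.sum_congr rfl fun i _ => by rw [ip_scale_left hs]; ring
    rw [h2, nrm_scale hs] at h
    nlinarith [sq_nonneg (dist (scale s x) x)]
  by_contra hne
  set δ := A - nrm x ^ 2 with hδ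
  have hδ0 : δ ≠ 0 := sub_ne_zero.mpr hne
  have hN : 0 < nrm x ^ 2 + 1 + |δ| := by positivity
  set t := δ / (nrm x ^ 2 + 1 + |δ|) with ht
  have htm : t * (nrm x ^ 2 + 1 + |δ|) = δ := div_mul_cancel₀ _ hN.ne'
  have ht1 : |t| ≤ 1 := by
    rw [ht, abs_div, abs_of_pos hN, div_le_one hN]
    nlinarith [sq_nonneg (nrm x)]
  have ht0 : 0 < t ^ 2 := by
    have : t ≠ 0 := div_ne_zero hδ0 hN.ne'
    positivity
  have h := key (1 + t) (by linarith [(abs_le.mp ht1).1])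
  have hA' : A = nrm x ^ 2 + δ := by ring
  rw [hA'] at h
  have h3 : t * δ = t ^ 2 * (nrm x ^ 2 + 1 + |δ|) := by
    linear_combination -t * htm
  have h4 : 0 ≤ t ^ 2 * (nrm x ^ 2 / 2 + |δ|) := by positivity
  nlinarith

lemma potential_bary {α : ι → ℝ} (hα : ∀ i, 0 ≤ α i) :
    potential z α (bary z α) = nrm (bary z α) ^ 2 / 2 := by
  rw [potential, sum_mul_ip_bary z hα]
  ring

lemma bary_eq_scale {α α' : ι → ℝ} (hα : ∀ i, 0 ≤ α i) (hα' : ∀ i, 0 ≤ α' i) {l : ℝ} (hl : 0 < l)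
    (h : ∀ i, α i ≠ 0 ∨ α' i ≠ 0 → ip (bary z α) (z i) = l * ip (bary z α') (z i)) :
    bary z α = scale l (bary z α') := by
  set x := bary z α with hx
  set x' := bary z α' with hx'
  have h1 := potential_le_bary z hα (scale l x')
  have h2 := potential_le_bary z hα' (scale l⁻¹ x)
  rw [potential_bary z hα, ← hx] at h1
  rw [potential_bary z hα', ← hx'] at h2
  have hs1 : ∑ i, α i * ip (scale l x') (z i) = nrm x ^ 2 := by
    rw [hx, ← sum_mul_ip_bary z hα]
    refine Finset.sum_congr rfl fun i _ => ?_
    by_cases hi : α i = 0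
    · simp [hi]
    · rw [ip_scale_left hl.le, ← hx, h i (Or.inl hi)]
  have hs2 : ∑ i, α' i * ip (scale l⁻¹ x) (z i) = nrm x' ^ 2 := by
    rw [hx', ← sum_mul_ip_bary z hα']
    refine Finset.sum_congr rfl fun i _ => ?_
    by_cases hi : α' i = 0
    · simp [hi]
    · rw [ip_scale_left (inv_pos.mpr hl).le, ← hx', h i (Or.inr hi), inv_mul_cancel_left₀ hl.ne']
  rw [potential, hs1, nrm_scale hl.le] at h1
  rw [potential, hs2, nrm_scale (inv_pos.mpr hl).le] at h2
  have h3 : nrm x' ^ 2 ≤ (l⁻¹ * nrm x) ^ 2 := by nlinarith [sq_nonneg (dist (scale l⁻¹ x) x')]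
  have h4 : (l * nrm x') ^ 2 ≤ nrm x ^ 2 := by
    calc (l * nrm x') ^ 2 = l ^ 2 * nrm x' ^ 2 := by ring
      _ ≤ l ^ 2 * (l⁻¹ * nrm x) ^ 2 := by gcongr
      _ = nrm x ^ 2 := by field_simp
  have h5 : dist (scale l x') x ^ 2 ≤ 0 := by nlinarith
  exact (dist_eq_zero.mp (pow_eq_zero_iff two_ne_zero |>.mp (le_antisymm h5 (sq_nonneg _)))).symm

end Barycentre

end MetricCone

namespace MetricCone

variable {C : Type*} [MetricSpace C] [MetricCone C] [CAT0Space C] [CompleteSpace C]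
  {ι : Type*} [Fintype ι]

/-- Nonnegative weights supported in `w` with bounded sum. -/
def weights (w : Finset ι) (B : ℝ) : Set (ι → ℝ) :=
  {β | (∀ i, 0 ≤ β i) ∧ (∀ i, i ∉ w → β i = 0) ∧ ∑ i, β i ≤ B}

lemma isCompact_weights (w : Finset ι) (B : ℝ) : IsCompact (weights w B) := by
  refine (isCompact_Icc (a := (0 : ι → ℝ)) (b := fun _ => B)).of_isClosed_subset ?_ ?_
  · simp only [weights, ofPred_and, ofPred_forall]
    refine (isClosed_iInter fun i => isClosed_le continuous_const (continuous_apply i)).inter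
      ((isClosed_iInter fun i => isClosed_iInter fun _ =>
        isClosed_eq (continuous_apply i) continuous_const).inter
      (isClosed_le (by fun_prop) continuous_const))
  · rintro β ⟨h0, -, hs⟩
    exact ⟨h0, fun i => (Finset.single_le_sum (fun j _ => h0 j) (Finset.mem_univ i)).trans hs⟩

variable (z : ι → C)

lemma continuousOn_bary_weights (w : Finset ι) (B : ℝ) : ContinuousOn (bary z) (weights w B) :=
  (continuousOn_bary z).mono fun _ h => h.1

lemma injOn_coords (w : Finset ι) (B : ℝ) :
    InjOn (fun (y : C) (i : w) => ip y (z i)) (bary z '' weights w B) := by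
  rintro _ ⟨β, hβ, rfl⟩ _ ⟨γ, hγ, rfl⟩ h
  rw [bary_eq_scale z hβ.1 hγ.1 one_pos, scale_one]
  intro i hi
  have hiw : i ∈ w := by
    by_contra hiw
    exact hi.elim (fun h => h (hβ.2.1 i hiw)) (fun h => h (hγ.2.1 i hiw))
  rw [one_mul]
  exact congrFun h ⟨i, hiw⟩

/-- If a point is only represented as a barycentre with weights of full support, then all nearby
coordinate values are attained. -/
lemma exists_bary_coords_eq {w : Finset ι} {α : ι → ℝ} (hα : ∀ i, 0 ≤ α i)
    (hαw : ∀ i, i ∉ w → α i = 0) (hF : ∀ i ∈ w, 1 / 2 ≤ ip (bary z α) (z i))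
    (hfull : ∀ β : ι → ℝ, (∀ i, 0 ≤ β i) → (∀ i, i ∉ w → β i = 0) → bary z β = bary z α →
      ∀ i ∈ w, 0 < β i) :
    ∃ δ > 0, ∃ B, ∀ y : ι → ℝ, (∀ i ∈ w, |y i - ip (bary z α) (z i)| ≤ δ) →
      ∃ β ∈ weights w B, ∀ i ∈ w, ip (bary z β) (z i) = y i := by
  classical
  set x := bary z α with hx
  set B := 2 * nrm x ^ 2 + 1 with hB
  have hB0 : 0 < B := by positivity
  have hsum : ∀ β : ι → ℝ, (∀ i, 0 ≤ β i) → (∀ i, i ∉ w → β i = 0) → bary z β = x →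
      ∑ i, β i ≤ 2 * nrm x ^ 2 := by
    intro β hβ hβw hβx
    have h1 := sum_mul_ip_bary z hβ
    rw [hβx] at h1
    rw [← h1, Finset.mul_sum]
    refine Finset.sum_le_sum fun i _ => ?_
    by_cases hi : i ∈ w
    · nlinarith [hβ i, hF i hi]
    · simp [hβw i hi]
  have hαA : α ∈ weights w B := ⟨hα, hαw, (hsum α hα hαw rfl).trans (by linarith)⟩
  set D : Set (ι → ℝ) := {β ∈ weights w B | (∃ i ∈ w, β i = 0) ∨ ∑ i, β i = B} with hD
  have hDc : IsCompact D := by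
    refine (isCompact_weights w B).inter_right (IsClosed.union ?_ ?_)
    · have : {β : ι → ℝ | ∃ i ∈ w, β i = 0} = ⋃ i ∈ w, {β | β i = 0} := by ext; simp
      change IsClosed {β : ι → ℝ | ∃ i ∈ w, β i = 0}
      rw [this]
      exact w.finite_toSet.isClosed_biUnion fun i _ =>
        isClosed_eq (continuous_apply i) continuous_const
    · exact isClosed_eq (by fun_prop) continuous_const
  have hpc : ContinuousOn (fun β => potential z β (bary z β)) (weights w B) := by
    have : ContinuousOn (fun β => nrm (bary z β) ^ 2 / 2) (weights w B) :=
      ((continuous_nrm.comp_continuousOn (continuousOn_bary_weights z w B)).pow 2).div_const 2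
    exact this.congr fun β hβ => potential_bary z hβ.1
  obtain ⟨m, hm0, hm⟩ := hDc.exists_forall_le'
    (f := fun β => potential z β (bary z β) - potential z β x) (a := 0)
    ((hpc.mono (sep_subset _ _)).sub (by unfold potential; fun_prop)) (by
      rintro β ⟨hβ, hβ'⟩
      have h1 := potential_le_bary z hβ.1 x
      have h2 : 0 < dist x (bary z β) := by
        rw [dist_pos]
        intro h
        rcases hβ' with ⟨i, hi, hi0⟩ | hs
        · exact (hfull β hβ.1 hβ.2.1 h.symm i hi).ne' hi0
        · have := hsum β hβ.1 hβ.2.1 h.symm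
          linarith
      have : 0 < dist x (bary z β) ^ 2 := by positivity
      linarith)
  refine ⟨m / (4 * B), by positivity, B, fun y hy => ?_⟩
  set J : (ι → ℝ) → ℝ := fun β => potential z β (bary z β) - ∑ i, β i * y i with hJ
  obtain ⟨β, hβ, hmin⟩ := (isCompact_weights w B).exists_isMinOn ⟨α, hαA⟩ (f := J)
    (hpc.sub (by fun_prop))
  have hest : ∀ γ ∈ weights w B, |∑ i, γ i * y i - ∑ i, γ i * ip x (z i)| ≤ m / 4 := by
    intro γ hγ
    rw [← Finset.sum_sub_distrib]
    refine (Finset.abs_sum_le_sum_abs _ _).trans ?_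
    have : ∑ i, |γ i * y i - γ i * ip x (z i)| ≤ ∑ i, γ i * (m / (4 * B)) := by
      refine Finset.sum_le_sum fun i _ => ?_
      rw [← mul_sub, abs_mul, abs_of_nonneg (hγ.1 i)]
      by_cases hi : i ∈ w
      · exact mul_le_mul_of_nonneg_left (hy i hi) (hγ.1 i)
      · simp [hγ.2.1 i hi]
    refine this.trans ?_
    rw [← Finset.sum_mul]
    calc (∑ i, γ i) * (m / (4 * B)) ≤ B * (m / (4 * B)) := by gcongr; exact hγ.2.2
      _ = m / 4 := by field_simp
  have hβD : β ∉ D := by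
    intro hβD
    have h1 := hm β hβD
    have h2 : J β ≤ J α := hmin hαA
    have h3 := abs_le.mp (hest β hβ)
    have h4 := abs_le.mp (hest α hαA)
    simp only [hJ, potential] at h1 h2
    rw [← hx] at h2
    linarith [h3.1, h3.2, h4.1, h4.2]
  have hpos : ∀ i ∈ w, 0 < β i := fun i hi =>
    (hβ.1 i).lt_of_ne fun h => hβD ⟨hβ, Or.inl ⟨i, hi, h.symm⟩⟩
  have hlt : ∑ i, β i < B := hβ.2.2.lt_of_ne fun h => hβD ⟨hβ, Or.inr h⟩
  refine ⟨β, hβ, fun i hi => ?_⟩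
  set γ : ℝ → ι → ℝ := fun t => Function.update β i (β i + t) with hγ
  have hγs : ∀ (t : ℝ) (G : ι → ℝ), ∑ j, γ t j * G j = ∑ j, β j * G j + t * G i := by
    intro t G
    have : ∀ j, γ t j * G j = β j * G j + if j = i then t * G i else 0 := by
      intro j
      rcases eq_or_ne j i with rfl | hj
      · simp [hγ, add_mul]
      · simp [hγ, hj]
    simp only [this, Finset.sum_add_distrib, Finset.sum_ite_eq', Finset.mem_univ, if_true]
  set τ := min (β i) (B - ∑ j, β j) with hτ
  have hτ0 : 0 < τ := lt_min (hpos i hi) (by linarith)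
  have hγA : ∀ t, |t| < τ → γ t ∈ weights w B := by
    intro t ht
    have ht1 := (abs_lt.mp (ht.trans_le (min_le_left _ _))).1
    have ht2 := (abs_lt.mp (ht.trans_le (min_le_right _ _))).2
    refine ⟨fun j => ?_, fun j hj => ?_, ?_⟩
    · rcases eq_or_ne j i with rfl | hj
      · simp only [hγ, Function.update_self]
        linarith
      · simpa [hγ, hj] using hβ.1 j
    · have : j ≠ i := fun h => hj (h ▸ hi)
      simpa [hγ, this] using hβ.2.1 j hj
    · have := hγs t (fun _ => 1)
      simp only [mul_one] at this
      linarith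
  have hγ0 : γ 0 = β := by simp [hγ]
  have hvar : ∀ t, |t| < τ → 0 ≤ t * (ip (bary z (γ t)) (z i) - y i) := by
    intro t ht
    have h1 : J β ≤ J (γ t) := hmin (hγA t ht)
    have h2 := potential_le_bary z hβ.1 (bary z (γ t))
    have h3 := hγs t (fun j => ip (bary z (γ t)) (z j))
    have h4 := hγs t y
    simp only [hJ, potential] at h1 h2
    nlinarith [sq_nonneg (dist (bary z (γ t)) (bary z β))]
  have hγc : Continuous γ := continuous_const.update i (continuous_const.add continuous_id')
  have hcont : ContinuousAt (fun t => ip (bary z (γ t)) (z i)) 0 := by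
    have h1 : ContinuousOn (fun t => bary z (γ t)) (Ioo (-τ) τ) :=
      (continuousOn_bary_weights z w B).comp hγc.continuousOn
        fun t ht => hγA t (abs_lt.mpr ht)
    exact ((continuous_ip_left (z i)).comp_continuousOn h1).continuousAt
      (Ioo_mem_nhds (by linarith) hτ0)
  have hnear : ∀ᶠ t : ℝ in 𝓝 0, |t| < τ := by
    have : Tendsto (fun t : ℝ => |t|) (𝓝 0) (𝓝 0) := by simpa using continuous_abs.tendsto (0 : ℝ)
    exact this.eventually (gt_mem_nhds hτ0)
  rcases lt_trichotomy (ip (bary z β) (z i)) (y i) with h | h | h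
  · exfalso
    have h1 := hcont.eventually (gt_mem_nhds (by simpa only [hγ0] using h))
    obtain ⟨t, ⟨h2, h3⟩, ht⟩ := (((h1.and hnear).filter_mono nhdsWithin_le_nhds).and
      (self_mem_nhdsWithin (s := Ioi (0 : ℝ)))).exists
    have ht : 0 < t := ht
    nlinarith [hvar t h3, mul_pos ht (sub_pos.mpr h2)]
  · exact h
  · exfalso
    have h1 := hcont.eventually (lt_mem_nhds (by simpa only [hγ0] using h))
    obtain ⟨t, ⟨h2, h3⟩, ht⟩ := (((h1.and hnear).filter_mono nhdsWithin_le_nhds).and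
      (self_mem_nhdsWithin (s := Iio (0 : ℝ)))).exists
    have ht : t < 0 := ht
    nlinarith [hvar t h3, mul_pos_of_neg_of_neg ht (sub_neg.mpr h2)]

/-- A barycentre of points making an acute angle with it is also a barycentre of a subfamily whose
coordinates embed a compact set with an image with nonempty interior. -/
lemma exists_minimal_support {α : ι → ℝ} (hα : ∀ i, 0 ≤ α i)
    (hF : ∀ i, α i ≠ 0 → 1 / 2 ≤ ip (bary z α) (z i)) :
    ∃ w : Finset ι, (∃ β : ι → ℝ, (∀ i, 0 ≤ β i) ∧ (∀ i, i ∉ w → β i = 0) ∧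
        bary z β = bary z α ∧ ∑ i, β i ≤ 2 * nrm (bary z α) ^ 2) ∧
      (∀ i ∈ w, 1 / 2 ≤ ip (bary z α) (z i)) ∧
      ∃ Q : Set C, IsCompact Q ∧ InjOn (fun (y : C) (i : w) => ip y (z i)) Q ∧
        (interior ((fun (y : C) (i : w) => ip y (z i)) '' Q)).Nonempty := by
  classical
  let P : Finset ι → Prop := fun w => (∀ i ∈ w, 1 / 2 ≤ ip (bary z α) (z i)) ∧
    ∃ β : ι → ℝ, (∀ i, 0 ≤ β i) ∧ (∀ i, i ∉ w → β i = 0) ∧ bary z β = bary z α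
  have hP : P {i | α i ≠ 0} := by
    refine ⟨fun i hi => hF i (by simpa using hi), α, hα, fun i hi => ?_, rfl⟩
    simpa using hi
  obtain ⟨w, -, hw⟩ := exists_minimal_le_of_wellFoundedLT P _ hP
  obtain ⟨hwF, β, hβ, hβw, hβx⟩ := hw.prop
  have hfull : ∀ γ : ι → ℝ, (∀ i, 0 ≤ γ i) → (∀ i, i ∉ w → γ i = 0) → bary z γ = bary z β →
      ∀ i ∈ w, 0 < γ i := by
    intro γ hγ hγw hγx i hi
    refine (hγ i).lt_of_ne fun h0 => ?_
    have : P (w.erase i) := by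
      refine ⟨fun j hj => hwF j (Finset.mem_of_mem_erase hj), γ, hγ, fun j hj => ?_,
        hγx.trans hβx⟩
      rcases eq_or_ne j i with rfl | hji
      · exact h0.symm
      · exact hγw j fun hjw => hj (Finset.mem_erase.mpr ⟨hji, hjw⟩)
    have h1 := hw.le_of_le this (Finset.erase_subset i w)
    exact Finset.notMem_erase i w (h1 hi)
  refine ⟨w, ⟨β, hβ, hβw, hβx, ?_⟩, hwF, ?_⟩
  · have h1 := sum_mul_ip_bary z hβ
    rw [hβx] at h1
    rw [← h1, Finset.mul_sum]
    refine Finset.sum_le_sum fun i _ => ?_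
    by_cases hi : i ∈ w
    · nlinarith [hβ i, hwF i hi]
    · simp [hβw i hi]
  · obtain ⟨δ, hδ, B, hball⟩ := exists_bary_coords_eq z hβ hβw (by rwa [hβx]) hfull
    refine ⟨bary z '' weights w B,
      (isCompact_weights w B).image_of_continuousOn (continuousOn_bary_weights z w B),
      injOn_coords z w B, fun i => ip (bary z β) (z i), ?_⟩
    rw [mem_interior_iff_mem_nhds]
    filter_upwards [Metric.closedBall_mem_nhds _ hδ] with y hy
    obtain ⟨γ, hγ, hγy⟩ := hball (fun i => if h : i ∈ w then y ⟨i, h⟩ else 0) (by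
      intro i hi
      rw [dif_pos hi]
      exact (dist_le_pi_dist y _ ⟨i, hi⟩).trans hy)
    refine ⟨_, ⟨γ, hγ, rfl⟩, ?_⟩
    funext i
    have := hγy i i.2
    rwa [dif_pos i.2] at this

end MetricCone

section Shrinking

/-- Open families covering `A` (indexed by `ι`) have open shrinkings of order at most `n` on `A`. -/
def ShrinkDim (ι : Type*) {Z : Type*} [TopologicalSpace Z] (A : Set Z) (n : ℕ) : Prop :=
  ∀ U : ι → Set Z, (∀ i, IsOpen (U i)) → A ⊆ ⋃ i, U i →
    ∃ V : ι → Set Z, (∀ i, IsOpen (V i)) ∧ (∀ i, V i ⊆ U i) ∧ A ⊆ ⋃ i, V i ∧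
      ∀ y ∈ A, {i | y ∈ V i}.encard ≤ n

lemma shrinkDim_empty (ι : Type*) {Z : Type*} [TopologicalSpace Z] (n : ℕ) :
    ShrinkDim ι (∅ : Set Z) n := fun U hU _ =>
  ⟨U, hU, fun _ => le_rfl, empty_subset _, fun _ hy => hy.elim⟩

variable {ι Z : Type*} [TopologicalSpace Z]

/-- Extend a shrinking covering a closed subset to a shrinking covering the whole set. -/
lemma ShrinkDim.exists_extend {A D : Set Z} {n : ℕ} (hA : IsClosed A) (h : ShrinkDim ι A n)
    (hAD : A ⊆ D) (U : ι → Set Z) (hU : ∀ i, IsOpen (U i)) (hD : D ⊆ ⋃ i, U i) :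
    ∃ V : ι → Set Z, (∀ i, IsOpen (V i)) ∧ (∀ i, V i ⊆ U i) ∧ D ⊆ ⋃ i, V i ∧
      ∀ y ∈ A, {i | y ∈ V i}.encard ≤ n := by
  obtain ⟨W, hWo, hWU, hWc, hWn⟩ := h U hU (hAD.trans hD)
  refine ⟨fun i => U i \ (A \ W i), fun i => (hU i).sdiff (hA.sdiff (hWo i)),
    fun i => sdiff_subset, fun y hy => ?_, fun y hy => ?_⟩
  · rw [mem_iUnion]
    by_cases hyA : y ∈ A
    · obtain ⟨i, hi⟩ := mem_iUnion.mp (hWc hyA)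
      exact ⟨i, hWU i hi, fun h => h.2 hi⟩
    · obtain ⟨i, hi⟩ := mem_iUnion.mp (hD hy)
      exact ⟨i, hi, fun h => hyA h.1⟩
  · refine (encard_le_encard ?_).trans (hWn y hy)
    intro i hi
    by_contra hiW
    exact hi.2 ⟨hy, hiW⟩

lemma ShrinkDim.union {A B : Set Z} {n : ℕ} (hA : IsClosed A) (hB : IsClosed B)
    (h : ShrinkDim ι A n) (h' : ShrinkDim ι B n) : ShrinkDim ι (A ∪ B) n := by
  intro U hU hc
  obtain ⟨V, hVo, hVU, hVc, hVn⟩ := h.exists_extend hA subset_union_left U hU hc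
  obtain ⟨W, hWo, hWV, hWc, hWn⟩ := h'.exists_extend hB subset_union_right V hVo hVc
  refine ⟨W, hWo, fun i => (hWV i).trans (hVU i), hWc, ?_⟩
  rintro y (hy | hy)
  · exact (encard_le_encard fun i hi => hWV i hi).trans (hVn y hy)
  · exact hWn y hy

lemma ShrinkDim.biUnion_finset {κ : Type*} (s : Finset κ) {A : κ → Set Z} {n : ℕ}
    (hA : ∀ k ∈ s, IsClosed (A k)) (h : ∀ k ∈ s, ShrinkDim ι (A k) n) :
    ShrinkDim ι (⋃ k ∈ s, A k) n := by
  classical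
  induction s using Finset.induction_on with
  | empty => simpa using shrinkDim_empty ι n
  | insert a s ha ih =>
    rw [Finset.set_biUnion_insert]
    have hA' : ∀ k ∈ s, IsClosed (A k) := fun k hk => hA k (Finset.mem_insert_of_mem hk)
    exact (h a (Finset.mem_insert_self a s)).union (hA a (Finset.mem_insert_self a s))
      (s.finite_toSet.isClosed_biUnion hA')
      (ih hA' fun k hk => h k (Finset.mem_insert_of_mem hk))

/-- For every vector one of `card κ + 1` shifts has no integral coordinate. -/
lemma exists_shift_no_int {κ : Type*} [Fintype κ] (v : κ → ℝ) :
    ∃ j : Fin (Fintype.card κ + 1), ∀ k, ∀ q : ℤ, v k - j / (Fintype.card κ + 1 : ℝ) ≠ q := by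
  by_contra! h
  choose k q hq using h
  have hcard : Fintype.card κ < Fintype.card (Fin (Fintype.card κ + 1)) := by simp
  obtain ⟨i, j, hij, hk⟩ := Fintype.exists_ne_map_eq_of_card_lt k hcard
  have h1 := hq i
  have h2 := hq j
  rw [← hk] at h2
  set N : ℝ := Fintype.card κ + 1 with hN
  have hN0 : 0 < N := by positivity
  have h3 : ((j : ℝ) - i) = ((q i - q j : ℤ) : ℝ) * N := by
    push_cast
    rw [← h1, ← h2]
    field_simp
    ring
  have h4 : ((j : ℤ) - i) = (q i - q j) * (Fintype.card κ + 1) := by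
    rw [hN] at h3
    exact_mod_cast h3
  have h5 : ((j : ℤ) - i) = 0 := by
    refine Int.eq_zero_of_abs_lt_dvd (m := (Fintype.card κ + 1 : ℕ)) ⟨q i - q j, ?_⟩ ?_
    · rw [h4]
      push_cast
      ring
    · rw [abs_lt]
      have := i.2
      have := j.2
      omega
  exact hij (Fin.ext (by omega))

/-- A compact set with an injective continuous map to a Euclidean space of dimension `< n`. -/
lemma shrinkDim_of_injOn [T2Space Z] {κ : Type*} [Fintype κ] {A : Set Z} (hA : IsCompact A)
    {u : Z → κ → ℝ} (hu : Continuous u) (hinj : InjOn u A) {n : ℕ} (hn : Fintype.card κ < n) :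
    ShrinkDim ι A n := by
  classical
  intro U hU hc
  rcases A.eq_empty_or_nonempty with rfl | ⟨a₀, ha₀⟩
  · exact shrinkDim_empty ι n U hU hc
  obtain ⟨i₀, -⟩ := mem_iUnion.mp (hc ha₀)
  have hO : ∀ i, IsOpen (u '' (A \ U i))ᶜ := fun i =>
    ((hA.diff (hU i)).image hu).isClosed.isOpen_compl
  have hOA : ∀ i, ∀ a ∈ A, u a ∈ (u '' (A \ U i))ᶜ → a ∈ U i := by
    intro i a ha h
    by_contra hi
    exact h ⟨a, ⟨ha, hi⟩, rfl⟩
  obtain ⟨δ, hδ, hleb⟩ := lebesgue_number_lemma_of_metric (hA.image hu) hO (by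
    rintro _ ⟨a, ha, rfl⟩
    obtain ⟨i, hi⟩ := mem_iUnion.mp (hc ha)
    refine mem_iUnion.mpr ⟨i, ?_⟩
    rintro ⟨a', ha', h⟩
    rw [hinj ha'.1 ha h] at ha'
    exact ha'.2 hi)
  set m := Fintype.card κ with hm
  let cube : Fin (m + 1) → (κ → ℤ) → Set (κ → ℝ) := fun j q =>
    {v | ∀ k, (q k : ℝ) < v k / δ - j / (m + 1 : ℝ) ∧ v k / δ - j / (m + 1 : ℝ) < q k + 1}
  have hcubeo : ∀ j q, IsOpen (cube j q) := by
    intro j q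
    have hrw : cube j q = ⋂ k, {v : κ → ℝ | (q k : ℝ) < v k / δ - j / (m + 1 : ℝ)} ∩
        {v : κ → ℝ | v k / δ - j / (m + 1 : ℝ) < q k + 1} := by
      ext v
      simp [cube]
    have hcoord : ∀ k, Continuous fun v : κ → ℝ => v k / δ - j / (m + 1 : ℝ) := fun k => by
      fun_prop
    rw [hrw]
    exact isOpen_iInter_of_finite fun k =>
      (isOpen_lt continuous_const (hcoord k)).inter (isOpen_lt (hcoord k) continuous_const)
  have hex : ∀ (j : Fin (m + 1)) (q : κ → ℤ), ∃ i, ∀ a ∈ A, u a ∈ cube j q → a ∈ U i := by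
    intro j q
    by_cases h : ∃ a ∈ A, u a ∈ cube j q
    · obtain ⟨a, ha, haq⟩ := h
      obtain ⟨i, hi⟩ := hleb (u a) (mem_image_of_mem u ha)
      refine ⟨i, fun b hb hbq => hOA i b hb (hi ?_)⟩
      rw [Metric.mem_ball, dist_pi_lt_iff hδ]
      intro k
      have h1 := haq k
      have h2 := hbq k
      have h3 : |u b k / δ - u a k / δ| < 1 := by
        rw [abs_lt]
        constructor <;> linarith [h1.1, h1.2, h2.1, h2.2]
      rwa [← sub_div, abs_div, abs_of_pos hδ, div_lt_one hδ] at h3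
    · exact ⟨i₀, fun a ha haq => (h ⟨a, ha, haq⟩).elim⟩
  choose idx hidx using hex
  refine ⟨fun i => U i ∩ ⋃ p : {p : Fin (m + 1) × (κ → ℤ) // idx p.1 p.2 = i},
      u ⁻¹' cube p.1.1 p.1.2, fun i => (hU i).inter (isOpen_iUnion fun p =>
        (hcubeo _ _).preimage hu), fun i => inter_subset_left, fun a ha => ?_, fun a ha => ?_⟩
  · obtain ⟨j, hj⟩ := exists_shift_no_int fun k => u a k / δ
    have hmem : u a ∈ cube j fun k => ⌊u a k / δ - j / (m + 1 : ℝ)⌋ := fun k =>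
      ⟨(Int.floor_le _).lt_of_ne fun h => hj k _ h.symm, Int.lt_floor_add_one _⟩
    exact mem_iUnion.mpr ⟨_, hidx _ _ a ha hmem, mem_iUnion.mpr ⟨⟨(j, _), rfl⟩, hmem⟩⟩
  · have hsub : {i | a ∈ U i ∩ ⋃ p : {p : Fin (m + 1) × (κ → ℤ) // idx p.1 p.2 = i},
        u ⁻¹' cube p.1.1 p.1.2} ⊆
        range fun j : Fin (m + 1) => idx j fun k => ⌊u a k / δ - j / (m + 1 : ℝ)⌋ := by
      rintro i ⟨-, hi⟩
      obtain ⟨⟨⟨j, q⟩, rfl⟩, hq⟩ := mem_iUnion.mp hi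
      refine ⟨j, ?_⟩
      have : (fun k => ⌊u a k / δ - j / (m + 1 : ℝ)⌋) = q := by
        funext k
        exact Int.floor_eq_iff.mpr ⟨(hq k).1.le, (hq k).2⟩
      simp only [this]
    refine (encard_le_encard hsub).trans ?_
    rw [← image_univ]
    refine (encard_image_le _ _).trans ?_
    rw [encard_univ, ENat.card_eq_coe_fintype_card, Fintype.card_fin]
    exact_mod_cast hn

end Shrinking

namespace MetricCone

variable {C : Type*} [MetricSpace C] [MetricCone C] [CAT0Space C]

section

variable {ι : Type*} [Fintype ι]

lemma potential_smul_scale (z : ι → C) (α : ι → ℝ) {s : ℝ} (hs : 0 ≤ s) (x : C) :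
    potential z (s • α) (scale s x) = s ^ 2 * potential z α x := by
  simp only [potential, ip_scale_left hs, nrm_scale hs, Pi.smul_apply, smul_eq_mul, mul_sub,
    Finset.mul_sum]
  congr 1
  · exact Finset.sum_congr rfl fun i _ => by ring
  · ring

variable [CompleteSpace C]

lemma bary_smul (z : ι → C) {α : ι → ℝ} (hα : ∀ i, 0 ≤ α i) {s : ℝ} (hs : 0 < s) :
    bary z (s • α) = scale s (bary z α) := by
  have hsα : ∀ i, 0 ≤ (s • α) i := fun i => mul_nonneg hs.le (hα i)
  symm
  refine eq_bary z hsα ?_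
  have h1 : bary z (s • α) = scale s (scale s⁻¹ (bary z (s • α))) := by
    rw [scale_scale hs.le (inv_pos.mpr hs).le, mul_inv_cancel₀ hs.ne', scale_one]
  rw [potential_smul_scale z α hs.le]
  conv_lhs => rw [h1]
  rw [potential_smul_scale z α hs.le]
  have h2 := potential_le_bary z hα (scale s⁻¹ (bary z (s • α)))
  exact mul_le_mul_of_nonneg_left (h2.trans (sub_le_self _ (by positivity))) (sq_nonneg s)

/-- Unit vectors which are barycentres of vertices in `w` and close to all these vertices. -/
def face (z : ι → C) (w : Finset ι) : Set C :=
  {y ∈ bary z '' weights w 2 | nrm y = 1 ∧ ∀ i ∈ w, 1 / 2 ≤ ip y (z i)}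

lemma isCompact_face (z : ι → C) (w : Finset ι) : IsCompact (face z w) := by
  refine ((isCompact_weights w 2).image_of_continuousOn
    (continuousOn_bary_weights z w 2)).inter_right ?_
  have h : IsClosed ({y | nrm y = 1} ∩ ⋂ i ∈ w, {y | 1 / 2 ≤ ip y (z i)}) :=
    (isClosed_eq continuous_nrm continuous_const).inter
      (isClosed_iInter fun i => isClosed_iInter fun _ =>
        isClosed_le continuous_const (continuous_ip_left (z i)))
  have heq : ({y | nrm y = 1} ∩ ⋂ i ∈ w, {y | 1 / 2 ≤ ip y (z i)}) =
      {y | nrm y = 1 ∧ ∀ i ∈ w, 1 / 2 ≤ ip y (z i)} := by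
    ext y
    simp
  rw [heq] at h
  exact h

lemma face_empty (z : ι → C) : face z ∅ = ∅ := by
  refine eq_empty_of_forall_notMem ?_
  rintro _ ⟨⟨β, hβ, rfl⟩, h1, -⟩
  have h := sum_mul_ip_bary z hβ.1
  rw [Finset.sum_eq_zero fun i _ => by rw [hβ.2.1 i (Finset.notMem_empty i), zero_mul], h1] at h
  norm_num at h

lemma shrinkDim_face {κ : Type*} (z : ι → C) {w : Finset ι} {n : ℕ} (hw : w.card ≤ n) :
    ShrinkDim κ (face z w) n := by
  classical
  rcases w.eq_empty_or_nonempty with rfl | ⟨i₀, hi₀⟩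
  · rw [face_empty]
    exact shrinkDim_empty κ n
  refine shrinkDim_of_injOn (κ := ↥(w.erase i₀)) (isCompact_face z w)
    (u := fun y k => ip y (z k) / max (ip y (z i₀)) (1 / 4)) ?_ ?_ ?_
  · refine continuous_pi fun k => (continuous_ip_left _).div₀
      ((continuous_ip_left _).max continuous_const) fun y => ?_
    exact (lt_of_lt_of_le (by norm_num) (le_max_right _ (1 / 4 : ℝ))).ne'
  · rintro _ ⟨⟨β, hβ, rfl⟩, h1, hF⟩ _ ⟨⟨γ, hγ, rfl⟩, h1', hF'⟩ h
    have hp : 0 < ip (bary z β) (z i₀) := by linarith [hF i₀ hi₀]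
    have hp' : 0 < ip (bary z γ) (z i₀) := by linarith [hF' i₀ hi₀]
    have hl : 0 < ip (bary z β) (z i₀) / ip (bary z γ) (z i₀) := div_pos hp hp'
    have key := bary_eq_scale z hβ.1 hγ.1 hl (by
      intro i hi
      have hiw : i ∈ w := by
        by_contra hiw
        exact hi.elim (fun h => h (hβ.2.1 i hiw)) (fun h => h (hγ.2.1 i hiw))
      by_cases hii : i = i₀
      · subst hii
        field_simp
      have h2 := congrFun h ⟨i, Finset.mem_erase.mpr ⟨hii, hiw⟩⟩
      simp only at h2
      rw [max_eq_left (by linarith [hF i₀ hi₀]), max_eq_left (by linarith [hF' i₀ hi₀]),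
        div_eq_div_iff hp.ne' hp'.ne'] at h2
      field_simp
      linarith)
    have hn := congrArg nrm key
    rw [nrm_scale hl.le, h1, h1', mul_one] at hn
    rw [key, ← hn, scale_one]
  · rw [Fintype.card_coe]
    exact (Finset.card_erase_lt_of_mem hi₀).trans_le hw

end

variable [CompleteSpace C]

/-- A partition-of-unity map from a set of unit vectors to a union of faces. -/
lemma exists_map_to_faces {Y : Type*} [TopologicalSpace Y] [CompactSpace Y] {τ : Y → C}
    (hτ : Continuous τ) (hn : ∀ y, nrm (τ y) = 1) {N : ℕ}
    (hN : ∀ (ι : Type) [Fintype ι] (Q : Set C), IsCompact Q → ∀ u : C → ι → ℝ, Continuous u →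
      InjOn u Q → (interior (u '' Q)).Nonempty → Fintype.card ι ≤ N)
    {ε : ℝ} (hε : 0 < ε) (hε1 : ε ≤ 1 / 10) :
    ∃ (k : ℕ) (z : Fin k → C) (π : Y → C), Continuous π ∧ (∀ y, dist (π y) (τ y) ≤ 6 * ε) ∧
      ∀ y, ∃ w : Finset (Fin k), w.card ≤ N ∧ π y ∈ face z w := by
  classical
  obtain ⟨t, htK, htf, htc⟩ := (isCompact_range hτ).finite_cover_balls hε
  obtain ⟨k, z, -, rfl⟩ := htf.fin_param
  have hz1 : ∀ i, nrm (z i) = 1 := fun i => by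
    obtain ⟨y, hy⟩ := htK (mem_range_self i)
    rw [← hy, hn]
  set a : Y → Fin k → ℝ := fun y i => max 0 (2 * ε - dist (τ y) (z i)) with ha
  have ha0 : ∀ y i, 0 ≤ a y i := fun y i => le_max_left _ _
  have hac : ∀ i, Continuous fun y => a y i := fun i => by
    simp only [ha]
    fun_prop
  have hS : ∀ y, 0 < ∑ i, a y i := by
    intro y
    have := htc (mem_range_self y)
    simp only [mem_range, iUnion_exists, iUnion_iUnion_eq', mem_iUnion, Metric.mem_ball] at this
    obtain ⟨i, hi⟩ := this
    refine Finset.sum_pos' (fun i _ => ha0 y i) ⟨i, Finset.mem_univ i, ?_⟩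
    exact lt_max_of_lt_right (by linarith)
  set α : Y → Fin k → ℝ := fun y i => a y i / ∑ j, a y j with hα
  have hα0 : ∀ y i, 0 ≤ α y i := fun y i => div_nonneg (ha0 y i) (hS y).le
  have hα1 : ∀ y, ∑ i, α y i = 1 := fun y => by
    simp only [hα]
    rw [← Finset.sum_div, div_self (hS y).ne']
  have hαc : Continuous α := continuous_pi fun i =>
    (hac i).div₀ (continuous_finsetSum _ fun j _ => hac j) fun y => (hS y).ne'
  have hαd : ∀ y i, α y i ≠ 0 → dist (τ y) (z i) < 2 * ε := by
    intro y i h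
    by_contra! hd
    exact h (by simp only [hα, ha]; rw [max_eq_left (by linarith), zero_div])
  have hip : ∀ y i, α y i ≠ 0 → 1 - 2 * ε ^ 2 ≤ ip (τ y) (z i) := by
    intro y i h
    unfold ip
    rw [hn, hz1]
    have := hαd y i h
    nlinarith [dist_nonneg (x := τ y) (y := z i)]
  set x : Y → C := fun y => bary z (α y) with hx
  have hxc : Continuous x := (continuousOn_bary z).comp_continuous hαc hα0
  have hx1 : ∀ y, nrm (x y) ≤ 1 := by
    intro y
    have h1 : ∑ i, α y i * ip (x y) (z i) ≤ nrm (x y) := by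
      calc ∑ i, α y i * ip (x y) (z i) ≤ ∑ i, α y i * nrm (x y) := by
            refine Finset.sum_le_sum fun i _ => mul_le_mul_of_nonneg_left ?_ (hα0 y i)
            simpa [hz1 i] using ip_le (x y) (z i)
        _ = nrm (x y) := by rw [← Finset.sum_mul, hα1, one_mul]
    rw [sum_mul_ip_bary z (hα0 y)] at h1
    by_contra! h
    have : nrm (x y) * 1 < nrm (x y) * nrm (x y) := by gcongr
    change nrm (x y) ^ 2 ≤ nrm (x y) at h1
    nlinarith
  have hxd : ∀ y, dist (x y) (τ y) ≤ 3 * ε := by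
    intro y
    have h1 := potential_le_bary z (hα0 y) (τ y)
    rw [potential_bary z (hα0 y)] at h1
    have h2 : 1 - 2 * ε ^ 2 ≤ ∑ i, α y i * ip (τ y) (z i) := by
      calc 1 - 2 * ε ^ 2 = ∑ i, α y i * (1 - 2 * ε ^ 2) := by
            rw [← Finset.sum_mul, hα1, one_mul]
        _ ≤ _ := by
            refine Finset.sum_le_sum fun i _ => ?_
            by_cases h : α y i = 0
            · simp [h]
            · exact mul_le_mul_of_nonneg_left (hip y i h) (hα0 y i)
    have h3 : nrm (x y) ^ 2 ≤ 1 := pow_le_one₀ (nrm_nonneg _) (hx1 y)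
    change nrm (bary z (α y)) ^ 2 ≤ 1 at h3
    simp only [potential, hn] at h1
    rw [dist_comm]
    refine abs_le_of_sq_le_sq' (?_ : dist (τ y) (x y) ^ 2 ≤ (3 * ε) ^ 2) (by positivity) |>.2
    change dist (τ y) (bary z (α y)) ^ 2 ≤ _
    nlinarith
  have hxn : ∀ y, 1 - 3 * ε ≤ nrm (x y) := by
    intro y
    have := dist_triangle (apex : C) (x y) (τ y)
    have h1 := hn y
    have h2 := hxd y
    unfold nrm at h1 ⊢
    linarith
  have hx0 : ∀ y, 0 < nrm (x y) := fun y => by linarith [hxn y]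
  have hπ : ∀ y, bary z ((nrm (x y))⁻¹ • α y) = scale (nrm (x y))⁻¹ (x y) := fun y =>
    bary_smul z (hα0 y) (inv_pos.mpr (hx0 y))
  refine ⟨k, z, fun y => scale (nrm (x y))⁻¹ (x y), ?_, fun y => ?_, fun y => ?_⟩
  · simp only [← hπ]
    refine (continuousOn_bary z).comp_continuous ?_ fun y i =>
      mul_nonneg (inv_pos.mpr (hx0 y)).le (hα0 y i)
    exact ((continuous_nrm.comp hxc).inv₀ fun y => (hx0 y).ne').smul hαc
  · have h1 : dist (scale (nrm (x y))⁻¹ (x y)) (x y) = |(nrm (x y))⁻¹ - 1| * nrm (x y) := by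
      have := dist_scale_self (inv_pos.mpr (hx0 y)).le zero_le_one (x y)
      rwa [scale_one] at this
    have h2 : dist (scale (nrm (x y))⁻¹ (x y)) (x y) = 1 - nrm (x y) := by
      rw [h1, abs_of_nonneg (sub_nonneg.mpr ((one_le_inv₀ (hx0 y)).mpr (hx1 y))), sub_mul,
        inv_mul_cancel₀ (hx0 y).ne', one_mul]
    linarith [dist_triangle (scale (nrm (x y))⁻¹ (x y)) (x y) (τ y), hxd y, hxn y]
  · obtain ⟨w, ⟨β, hβ0, hβw, hβx, hβs⟩, hF, Q, hQ, hinj, hint⟩ :=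
      exists_minimal_support z (hα0 y) (by
        intro i hi
        have h1 := abs_le.mp (abs_ip_sub_ip_le (x y) (τ y) (z i))
        rw [hz1, mul_one] at h1
        change 1 / 2 ≤ ip (x y) (z i)
        nlinarith [hip y i hi, hxd y])
    change bary z β = x y at hβx
    change ∑ i, β i ≤ 2 * nrm (x y) ^ 2 at hβs
    have hi0 := (inv_pos.mpr (hx0 y)).le
    refine ⟨w, ?_, ⟨(nrm (x y))⁻¹ • β, ⟨fun i => mul_nonneg hi0 (hβ0 i), fun i hi => ?_, ?_⟩, ?_⟩,
      ?_, fun i hi => ?_⟩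
    · simpa using hN w Q hQ _ (continuous_coords z w) hinj hint
    · rw [Pi.smul_apply, hβw i hi, smul_zero]
    · simp only [Pi.smul_apply, smul_eq_mul]
      rw [← Finset.mul_sum, inv_mul_le_iff₀ (hx0 y)]
      nlinarith [hx1 y, hx0 y]
    · rw [bary_smul z hβ0 (inv_pos.mpr (hx0 y)), hβx]
    · rw [nrm_scale hi0, inv_mul_cancel₀ (hx0 y).ne']
    · rw [ip_scale_left hi0]
      have h1 : 1 / 2 ≤ ip (x y) (z i) := hF i hi
      have h2 : 1 ≤ (nrm (x y))⁻¹ := (one_le_inv₀ (hx0 y)).mpr (hx1 y)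
      nlinarith

/-- The covering dimension of the link of a metric cone is bounded in terms of the topological
dimension of the cone, as detected by embedded cubes. -/
theorem covDimLE_of_injective {Y : Type*} [TopologicalSpace Y] [CompactSpace Y] {τ : Y → C}
    (hτ : Continuous τ) (hinj : Function.Injective τ) (hn : ∀ y, nrm (τ y) = 1) {N : ℕ}
    (hN : ∀ (ι : Type) [Fintype ι] (Q : Set C), IsCompact Q → ∀ u : C → ι → ℝ, Continuous u →
      InjOn u Q → (interior (u '' Q)).Nonempty → Fintype.card ι ≤ N) :
    CovDimLE Y ((N : ℤ) - 1) := by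
  classical
  intro 𝒰 hUo hUc
  obtain ⟨η, hη, hleb⟩ : ∃ η > 0, ∀ y, ∃ U ∈ 𝒰, ∀ y', dist (τ y') (τ y) < η → y' ∈ U := by
    obtain ⟨η, hη, h⟩ := lebesgue_number_lemma_of_metric (isCompact_range hτ)
      (c := fun U : 𝒰 => (τ '' U.1ᶜ)ᶜ)
      (fun U => ((hUo U.1 U.2).isClosed_compl.isCompact.image hτ).isClosed.isOpen_compl) (by
        rintro _ ⟨y, rfl⟩
        have hy : y ∈ ⋃₀ 𝒰 := hUc ▸ mem_univ y
        obtain ⟨U, hU, hyU⟩ := hy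
        refine mem_iUnion.mpr ⟨⟨U, hU⟩, ?_⟩
        rintro ⟨y', hy', h⟩
        exact hy' (hinj h ▸ hyU))
    refine ⟨η, hη, fun y => ?_⟩
    obtain ⟨U, hU⟩ := h (τ y) (mem_range_self y)
    refine ⟨U.1, U.2, fun y' hy' => ?_⟩
    by_contra hc
    exact hU (Metric.mem_ball.mpr hy') ⟨y', hc, rfl⟩
  set ε := min (η / 15) (1 / 10) with hε
  have hε0 : 0 < ε := by positivity
  have hεη : 14 * ε < η := by linarith [min_le_left (η / 15) (1 / 10)]
  obtain ⟨k, z, π, hπ, hπd, hπf⟩ := exists_map_to_faces hτ hn hN hε0 (min_le_right _ _)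
  set s : Finset (Finset (Fin k)) := Finset.univ.filter fun w => w.card ≤ N with hs
  have hdim : ShrinkDim C (⋃ w ∈ s, face z w) N :=
    ShrinkDim.biUnion_finset s (fun w _ => (isCompact_face z w).isClosed)
      fun w hw => shrinkDim_face z (Finset.mem_filter.mp hw).2
  obtain ⟨V, hVo, hVb, hVc, hVn⟩ := hdim (fun c => Metric.ball c ε) (fun c => Metric.isOpen_ball)
    fun c _ => mem_iUnion.mpr ⟨c, Metric.mem_ball_self hε0⟩
  have hmem : ∀ y, π y ∈ ⋃ w ∈ s, face z w := fun y => by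
    obtain ⟨w, hw, hy⟩ := hπf y
    exact mem_biUnion (show w ∈ (s : Set _) by simpa [hs] using hw) hy
  refine ⟨{W | W.Nonempty ∧ ∃ c, W = π ⁻¹' V c}, ?_, ?_, ?_, fun y => ?_⟩
  · rintro _ ⟨-, c, rfl⟩
    exact (hVo c).preimage hπ
  · refine eq_univ_of_forall fun y => ?_
    obtain ⟨c, hc⟩ := mem_iUnion.mp (hVc (hmem y))
    exact ⟨π ⁻¹' V c, ⟨⟨y, hc⟩, c, rfl⟩, hc⟩
  · rintro _ ⟨⟨y₀, hy₀⟩, c, rfl⟩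
    obtain ⟨U, hU, h⟩ := hleb y₀
    refine ⟨U, hU, fun y hy => h y ?_⟩
    have h1 := Metric.mem_ball.mp (hVb c hy)
    have h2 := Metric.mem_ball.mp (hVb c hy₀)
    have h3 := dist_triangle4 (τ y) (π y) (π y₀) (τ y₀)
    have h4 := dist_triangle_right (π y) (π y₀) c
    have h5 := hπd y
    rw [dist_comm] at h5
    linarith [hπd y₀]
  · have hsub : {W ∈ {W | W.Nonempty ∧ ∃ c, W = π ⁻¹' V c} | y ∈ W} ⊆
        (fun c => π ⁻¹' V c) '' {c | π y ∈ V c} := by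
      rintro _ ⟨⟨-, c, rfl⟩, hy⟩
      exact ⟨c, hy, rfl⟩
    have hle := (encard_le_encard hsub).trans ((encard_image_le _ _).trans (hVn _ (hmem y)))
    refine ⟨finite_of_encard_le_coe hle, ?_, by omega⟩
    rw [sub_add_cancel, Int.toNat_natCast]
    rw [← (finite_of_encard_le_coe hle).cast_ncard_eq] at hle
    exact_mod_cast hle

end MetricCone

section NoRetraction

open MeasureTheory

/-- Interpolation of `t ↦ det (1 + t A)` at `t = 1` from prescribed nodes. -/
lemma exists_det_interpolation (E : Type*) [NormedAddCommGroup E] [NormedSpace ℝ E]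
    [FiniteDimensional ℝ E] {v : ℕ → ℝ} (hv : Function.Injective v) :
    ∃ (s : Finset ℕ) (c : ℕ → ℝ), ∀ A : E →L[ℝ] E,
      (1 + A).det = ∑ j ∈ s, c j * (1 + v j • A).det := by
  classical
  set n := Module.finrank ℝ E
  set b := Module.finBasis ℝ E
  refine ⟨Finset.range (n + 1), fun j => (Lagrange.basis (Finset.range (n + 1)) v j).eval 1,
    fun A => ?_⟩
  set M := LinearMap.toMatrix b b A.toLinearMap with hM
  set P : Polynomial ℝ := ((Polynomial.X : Polynomial ℝ) • M.map (Polynomial.C : ℝ →+* _) +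
    (1 : Matrix (Fin n) (Fin n) ℝ).map (Polynomial.C : ℝ →+* _)).det with hP
  have heval : ∀ t : ℝ, P.eval t = (1 + t • A).det := by
    intro t
    have h1 : (1 + t • A).det = (1 + t • M).det := by
      rw [hM, ← LinearMap.toMatrix_one b, ← map_smul, ← map_add, LinearMap.det_toMatrix]
      rfl
    rw [h1, hP, ← Polynomial.coe_evalRingHom, RingHom.map_det]
    congr 1
    ext i j
    simp only [RingHom.mapMatrix_apply, Matrix.map_apply, Matrix.add_apply, Matrix.smul_apply,
      smul_eq_mul, map_add, Polynomial.coe_evalRingHom, Polynomial.eval_mul, Polynomial.eval_X,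
      Polynomial.eval_C]
    rw [add_comm]
  have hdeg : P.degree < (Finset.range (n + 1)).card := by
    rw [Finset.card_range]
    refine Polynomial.degree_le_natDegree.trans_lt ?_
    have := Polynomial.natDegree_det_X_add_C_le M 1
    rw [Fintype.card_fin] at this
    exact_mod_cast Nat.lt_succ_of_le this
  have h := congrArg (Polynomial.eval 1) (Lagrange.eq_interpolate hv.injOn hdeg)
  rw [heval, one_smul, Lagrange.interpolate_apply, Polynomial.eval_finsetSum] at h
  rw [h]
  refine Finset.sum_congr rfl fun j _ => ?_
  rw [Polynomial.eval_mul, Polynomial.eval_C, heval, mul_comm]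

variable {E : Type*} [NormedAddCommGroup E] [InnerProductSpace ℝ E] [FiniteDimensional ℝ E]

lemma det_one_add_ne_zero {A : E →L[ℝ] E} (hA : ‖A‖ < 1) : (1 + A).det ≠ 0 := by
  intro h
  obtain ⟨v, hv, hv0⟩ := Submodule.exists_mem_ne_zero_of_ne_bot
    (LinearMap.bot_lt_ker_of_det_eq_zero h).ne'
  have h1 : v + A v = 0 := hv
  have h2 : ‖v‖ = ‖A v‖ := by
    rw [← norm_neg, ← eq_neg_of_add_eq_zero_right h1]
  have h3 := A.le_opNorm v
  have h4 : 0 < ‖v‖ := norm_pos_iff.mpr hv0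
  nlinarith

lemma det_one_add_pos {A : E →L[ℝ] E} (hA : ‖A‖ < 1) : 0 < (1 + A).det := by
  by_contra! h
  have hc : ContinuousOn (fun s : ℝ => (1 + s • A).det) (Icc 0 1) :=
    (ContinuousLinearMap.continuous_det.comp (by fun_prop)).continuousOn
  have h1 : (1 : E →L[ℝ] E).det = 1 := LinearMap.det_id
  obtain ⟨s, hs, hs0⟩ := intermediate_value_Icc' zero_le_one hc
    (show (0 : ℝ) ∈ Icc _ _ by simpa [h1] using h)
  refine det_one_add_ne_zero ?_ hs0
  rw [norm_smul, Real.norm_eq_abs, abs_of_nonneg hs.1]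
  nlinarith [norm_nonneg A, hs.2]

/-- Small `C¹` perturbations of the identity fixing the sphere preserve the volume of the ball. -/
lemma integral_det_one_add_smul_fderiv [MeasurableSpace E] [BorelSpace E] [Nontrivial E]
    {u : E → E} (hu : ContDiff ℝ 1 u) {r : ℝ} (hr : 0 < r) (hsph : ∀ x, ‖x‖ = r → u x = 0)
    (hball : ∀ x, ‖x‖ ≤ r → ‖x + u x‖ ≤ r) {K : ℝ}
    (hK : ∀ x ∈ Metric.closedBall (0 : E) r, ‖fderiv ℝ u x‖ ≤ K) {t : ℝ} (ht : 0 < t)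
    (ht1 : t < 1) (htK : t * K < 1) :
    ∫ x in Metric.ball (0 : E) r, (1 + t • fderiv ℝ u x).det = volume.real (Metric.ball (0 : E) r) := by
  have hd : ∀ x, DifferentiableAt ℝ u x := fun x => hu.differentiable one_ne_zero x
  set H : E → E := fun x => x + t • u x with hH
  have hHc : Continuous H := continuous_id.add (continuous_const.smul hu.continuous)
  have hHd : ∀ x, HasFDerivAt H (1 + t • fderiv ℝ u x) x := fun x =>
    (hasFDerivAt_id x).add ((hd x).hasFDerivAt.const_smul t)
  have hK0 : 0 ≤ K := (norm_nonneg _).trans (hK 0 (Metric.mem_closedBall_self hr.le))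
  have happ : ApproximatesLinearOn H ((ContinuousLinearEquiv.refl ℝ E : E ≃L[ℝ] E) : E →L[ℝ] E)
      (Metric.ball 0 r) ⟨t * K, mul_nonneg ht.le hK0⟩ := by
    intro x hx y hy
    have h1 := (convex_closedBall (0 : E) r).norm_image_sub_le_of_norm_fderiv_le
      (fun z _ => hd z) hK (Metric.ball_subset_closedBall hy) (Metric.ball_subset_closedBall hx)
    have h2 : H x - H y - (x - y) = t • (u x - u y) := by
      simp only [hH, smul_sub]
      abel
    change ‖H x - H y - (x - y)‖ ≤ t * K * ‖x - y‖
    rw [h2, norm_smul, Real.norm_eq_abs, abs_of_pos ht, mul_assoc]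
    exact mul_le_mul_of_nonneg_left h1 ht.le
  have hN : Subsingleton E ∨ (⟨t * K, mul_nonneg ht.le hK0⟩ : NNReal) <
      ‖((ContinuousLinearEquiv.refl ℝ E).symm : E →L[ℝ] E)‖₊⁻¹ := by
    right
    have : ‖((ContinuousLinearEquiv.refl ℝ E).symm : E →L[ℝ] E)‖₊ = 1 :=
      NNReal.eq (ContinuousLinearMap.norm_id (𝕜 := ℝ) (E := E))
    rw [this, inv_one]
    exact htK
  have hinj : InjOn H (Metric.ball 0 r) := happ.injOn hN
  have hopen : IsOpen (H '' Metric.ball 0 r) :=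
    (happ.toOpenPartialHomeomorph H _ hN Metric.isOpen_ball).open_target
  have himg : H '' Metric.ball 0 r = Metric.ball 0 r := by
    have hmaps : ∀ x ∈ Metric.ball (0 : E) r, H x ∈ Metric.ball (0 : E) r := by
      intro x hx
      rw [mem_ball_zero_iff] at hx ⊢
      have h1 : H x = (1 - t) • x + t • (x + u x) := by
        simp only [hH, smul_add, sub_smul, one_smul]
        abel
      rw [h1]
      refine (norm_add_le _ _).trans_lt ?_
      rw [norm_smul, norm_smul, Real.norm_eq_abs, Real.norm_eq_abs, abs_of_pos ht,
        abs_of_pos (sub_pos.mpr ht1)]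
      nlinarith [hball x hx.le, mul_lt_mul_of_pos_left hx (sub_pos.mpr ht1)]
    refine Subset.antisymm (image_subset_iff.mpr hmaps) ?_
    have hcl : IsClosed (H '' Metric.closedBall 0 r) :=
      ((isCompact_closedBall 0 r).image hHc).isClosed
    refine IsPreconnected.subset_left_of_subset_union hopen hcl.isOpen_compl ?_ ?_ ?_
      (convex_ball (0 : E) r).isPreconnected
    · exact disjoint_compl_right.mono_left (image_mono Metric.ball_subset_closedBall)
    · intro y hy
      by_cases h : y ∈ H '' Metric.closedBall 0 r
      · left
        obtain ⟨x, hx, rfl⟩ := h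
        rw [mem_closedBall_zero_iff] at hx
        rcases hx.lt_or_eq with hx | hx
        · exact ⟨x, mem_ball_zero_iff.mpr hx, rfl⟩
        · rw [mem_ball_zero_iff] at hy
          simp only [hH, hsph x hx, smul_zero, add_zero] at hy
          exact (hy.ne hx).elim
      · exact Or.inr h
    · exact ⟨H 0, hmaps 0 (Metric.mem_ball_self hr), 0, Metric.mem_ball_self hr, rfl⟩
  have hcv := integral_image_eq_integral_abs_det_fderiv_smul volume Metric.isOpen_ball.measurableSet
    (fun x _ => (hHd x).hasFDerivWithinAt) hinj fun _ => (1 : ℝ)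
  rw [himg, setIntegral_const, smul_eq_mul, mul_one] at hcv
  rw [hcv]
  refine setIntegral_congr_fun Metric.isOpen_ball.measurableSet fun x hx => ?_
  simp only [smul_eq_mul, mul_one]
  refine (abs_of_pos (det_one_add_pos ?_)).symm
  rw [norm_smul, Real.norm_eq_abs, abs_of_pos ht]
  exact (mul_le_mul_of_nonneg_left (hK x (Metric.ball_subset_closedBall hx)) ht.le).trans_lt htK

/-- A `C¹` map which is the identity outside a ball has a zero (no-retraction theorem). -/
theorem exists_eq_zero_of_eq_self [MeasurableSpace E] [BorelSpace E] {F : E → E}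
    (hF : ContDiff ℝ 1 F) {r : ℝ} (hr : 0 < r) (h : ∀ x, r ≤ ‖x‖ → F x = x) : ∃ x, F x = 0 := by
  by_contra! hne
  have : Nontrivial E := ⟨⟨F 0, 0, hne 0⟩⟩
  have hn0 : ∀ x, ‖F x‖ ≠ 0 := fun x => norm_ne_zero_iff.mpr (hne x)
  set G : E → E := fun x => (r / ‖F x‖) • F x with hG
  have hGd : ContDiff ℝ 1 G := (contDiff_const.div (hF.norm ℝ hne) hn0).smul hF
  have hGn : ∀ x, ‖G x‖ = r := by
    intro x
    rw [hG, norm_smul, norm_div, norm_norm, Real.norm_eq_abs, abs_of_pos hr,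
      div_mul_cancel₀ _ (hn0 x)]
  set u : E → E := fun x => G x - x with hu
  have hud : ContDiff ℝ 1 u := hGd.sub contDiff_id
  have hxu : ∀ x, x + u x = G x := fun x => by simp [hu]
  have hdet : ∀ x, (1 + fderiv ℝ u x).det = 0 := by
    intro x
    have hGx : HasFDerivAt G (1 + fderiv ℝ u x) x := by
      have h1 := (hasFDerivAt_id x).add (hud.differentiable one_ne_zero x).hasFDerivAt
      exact h1.congr_of_eventuallyEq (Eventually.of_forall fun y => (hxu y).symm)
    have horth : ∀ w, inner ℝ (G x) ((1 + fderiv ℝ u x) w) = 0 := by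
      intro w
      have h1 := hGx.norm_sq
      have h2 : HasFDerivAt (fun y => ‖G y‖ ^ 2) (0 : E →L[ℝ] ℝ) x := by
        simp only [hGn]
        exact hasFDerivAt_const _ _
      have h3 := congrArg (fun L : E →L[ℝ] ℝ => L w) (h1.unique h2)
      have h4 : 2 * inner ℝ (G x) w + 2 * inner ℝ (G x) (fderiv ℝ u x w) = 0 := by
        simpa using h3
      change inner ℝ (G x) (w + fderiv ℝ u x w) = 0
      rw [inner_add_right]
      linarith
    by_contra hd
    obtain ⟨w, hw⟩ := (LinearMap.equivOfDetNeZero _ hd).surjective (G x)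
    have h1 : (1 + fderiv ℝ u x) w = G x := hw
    have h2 := horth w
    rw [h1, real_inner_self_eq_norm_sq, hGn] at h2
    exact (pow_pos hr 2).ne' h2
  have hdc : Continuous (fderiv ℝ u) := hud.continuous_fderiv one_ne_zero
  obtain ⟨K, hK⟩ := (isCompact_closedBall (0 : E) r).exists_bound_of_continuousOn hdc.continuousOn
  have hK0 : 0 ≤ K := (norm_nonneg _).trans (hK 0 (Metric.mem_closedBall_self hr.le))
  set v : ℕ → ℝ := fun j => 1 / ((K + 1) * (j + 2)) with hv
  have hvinj : Function.Injective v := by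
    intro i j hij
    simp only [hv] at hij
    have hK1 : K + 1 ≠ 0 := by positivity
    rw [one_div, one_div, inv_inj] at hij
    have h2 := mul_left_cancel₀ hK1 hij
    exact_mod_cast add_right_cancel h2
  have hvol : ∀ j, ∫ x in Metric.ball (0 : E) r, (1 + v j • fderiv ℝ u x).det =
      volume.real (Metric.ball (0 : E) r) := by
    intro j
    have hp : 0 < (K + 1) * ((j : ℝ) + 2) := by positivity
    refine integral_det_one_add_smul_fderiv hud hr (fun x hx => ?_) (fun x _ => ?_) hK
      (by positivity) ?_ ?_
    · simp only [hu, hG]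
      rw [h x hx.ge, hx, div_self hr.ne', one_smul, sub_self]
    · rw [hxu, hGn]
    · rw [div_lt_one hp]
      nlinarith [(Nat.cast_nonneg j : (0 : ℝ) ≤ j)]
    · rw [div_mul_eq_mul_div, one_mul, div_lt_one hp]
      nlinarith [(Nat.cast_nonneg j : (0 : ℝ) ≤ j)]
  obtain ⟨s, c, hc⟩ := exists_det_interpolation E hvinj
  have hint : ∀ j, IntegrableOn (fun x => (1 + v j • fderiv ℝ u x).det) (Metric.ball (0 : E) r) := by
    intro j
    refine (ContinuousOn.integrableOn_compact (isCompact_closedBall 0 r) ?_).mono_set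
      Metric.ball_subset_closedBall
    exact (ContinuousLinearMap.continuous_det.comp (by fun_prop)).continuousOn
  have hzero : (0 : ℝ) = (∑ j ∈ s, c j) * volume.real (Metric.ball (0 : E) r) := by
    calc (0 : ℝ) = ∫ x in Metric.ball (0 : E) r, ∑ j ∈ s, c j * (1 + v j • fderiv ℝ u x).det := by
          simp only [← hc, hdet, integral_zero]
      _ = _ := by
          rw [integral_finsetSum _ fun j _ => (hint j).const_mul (c j), Finset.sum_mul]
          exact Finset.sum_congr rfl fun j _ => by rw [integral_const_mul, hvol]
  have hone : ∑ j ∈ s, c j = 1 := by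
    have h1 := hc 0
    have h2 : (1 : E →L[ℝ] E).det = 1 := LinearMap.det_id
    simpa [h2] using h1.symm
  rw [hone, one_mul] at hzero
  have hpos : 0 < volume.real (Metric.ball (0 : E) r) :=
    ENNReal.toReal_pos (Metric.measure_ball_pos volume 0 hr).ne' measure_ball_lt_top.ne
  exact hpos.ne hzero

end NoRetraction

lemma affineSpan_image_ne_top {κ E : Type*} [NormedAddCommGroup E] [InnerProductSpace ℝ E]
    (p : κ → E) (s : Finset κ) (hs : s.card ≤ Module.finrank ℝ E) :
    affineSpan ℝ (p '' s) ≠ ⊤ := by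
  classical
  intro h
  rcases s.eq_empty_or_nonempty with rfl | hne
  · simp only [Finset.coe_empty, image_empty, AffineSubspace.span_empty] at h
    exact AffineSubspace.bot_ne_top ℝ E E h
  · obtain ⟨k, hk⟩ := Nat.exists_eq_succ_of_ne_zero (Finset.card_pos.mpr hne).ne'
    have h1 := finrank_vectorSpan_image_finset_le ℝ p s hk
    rw [Finset.coe_image, ← direction_affineSpan, h, AffineSubspace.direction_top,
      finrank_top] at h1
    omega

section LowerBound

open MeasureTheory Manifold

variable {E : Type*} [NormedAddCommGroup E] [InnerProductSpace ℝ E] [FiniteDimensional ℝ E]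

/-- A `C¹` map close to the identity on a ball covers a smaller ball. -/
lemma closedBall_subset_image_of_close {f : E → E} (hf : ContDiff ℝ 1 f) {c : E} {R : ℝ}
    (hR : 0 < R) (hfc : ∀ x ∈ Metric.closedBall c R, ‖f x - x‖ ≤ R / 16) :
    Metric.closedBall c (R / 2) ⊆ f '' Metric.closedBall c R := by
  intro c' hc'
  let _ : MeasurableSpace E := borel E
  have : BorelSpace E := ⟨rfl⟩
  let χ : ContDiffBump c' := ⟨R / 8, R / 4, by positivity, by linarith⟩
  have hχ : ContDiff ℝ 1 χ := χ.contDiff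
  obtain ⟨y, hy⟩ := exists_eq_zero_of_eq_self
    (F := fun y => y + χ (c' + y) • (f (c' + y) - (c' + y))) (r := R / 4)
    (by fun_prop) (by positivity) (fun y hy => by
      have : χ (c' + y) = 0 := χ.zero_of_le_dist (by simpa [dist_eq_norm] using hy)
      simp [this])
  have hmem : ‖y‖ ≤ R / 2 → c' + y ∈ Metric.closedBall c R := fun h => by
    rw [mem_closedBall_iff_norm] at hc' ⊢
    calc ‖c' + y - c‖ = ‖(c' - c) + y‖ := by congr 1; abel
      _ ≤ R := (norm_add_le _ _).trans (by linarith)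
  rcases le_or_gt ‖y‖ (R / 8) with h | h
  · have h1 : χ (c' + y) = 1 := χ.one_of_mem_closedBall (by
      simpa [mem_closedBall_iff_norm] using h)
    refine ⟨c' + y, hmem (by linarith), ?_⟩
    rw [h1, one_smul] at hy
    have : f (c' + y) - c' = 0 := by rw [← hy]; abel
    exact sub_eq_zero.mp this
  · exfalso
    rcases le_or_gt (R / 4) ‖y‖ with h2 | h2
    · have h1 : χ (c' + y) = 0 := χ.zero_of_le_dist (by simpa [dist_eq_norm] using h2)
      rw [h1, zero_smul, add_zero] at hy
      rw [hy, norm_zero] at h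
      linarith
    · have h3 : ‖y‖ = ‖χ (c' + y) • (f (c' + y) - (c' + y))‖ := by
        rw [eq_neg_of_add_eq_zero_left hy, norm_neg, ← eq_neg_of_add_eq_zero_left hy]
      have h4 : ‖χ (c' + y) • (f (c' + y) - (c' + y))‖ ≤ 1 * (R / 16) := by
        rw [norm_smul, Real.norm_eq_abs, abs_of_nonneg χ.nonneg]
        exact mul_le_mul χ.le_one (hfc _ (hmem (by linarith))) (norm_nonneg _) zero_le_one
      linarith

/-- A compact space of covering dimension less than `dim E` cannot be embedded in `E` with
nonempty interior. -/
theorem interior_range_eq_empty_of_covDimLE [MeasurableSpace E] [BorelSpace E] {Y : Type*}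
    [TopologicalSpace Y] [CompactSpace Y] (h : CovDimLE Y ((Module.finrank ℝ E : ℤ) - 1))
    {v : Y → E} (hv : Continuous v) (hinj : Function.Injective v) : interior (range v) = ∅ := by
  classical
  by_contra hne
  obtain ⟨c, hc⟩ := nonempty_iff_ne_empty.mpr hne
  obtain ⟨R, hR, hball⟩ := Metric.nhds_basis_closedBall.mem_iff.mp (mem_interior_iff_mem_nhds.mp hc)
  obtain ⟨𝒱, hVo, hVc, hVr, hVn⟩ := h (range fun p : E => v ⁻¹' Metric.ball p (R / 16))
    (by rintro _ ⟨p, rfl⟩; exact Metric.isOpen_ball.preimage hv)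
    (eq_univ_of_forall fun y => ⟨_, ⟨v y, rfl⟩, Metric.mem_ball_self (by positivity)⟩)
  have hVp : ∀ V : 𝒱, ∃ p : E, V.1 ⊆ v ⁻¹' Metric.ball p (R / 16) := fun V => by
    obtain ⟨_, ⟨p, rfl⟩, hp⟩ := hVr V.1 V.2
    exact ⟨p, hp⟩
  choose p hp using hVp
  obtain ⟨t, ht⟩ := isCompact_univ.elim_finite_subcover (fun V : 𝒱 => V.1) (fun V => hVo V.1 V.2)
    (by rw [← sUnion_eq_iUnion, hVc])
  let O : t → Set E := fun i => (v '' i.1.1ᶜ)ᶜ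
  have hO : ∀ i, IsOpen (O i) := fun i =>
    ((hVo _ i.1.2).isClosed_compl.isCompact.image hv).isClosed.isOpen_compl
  have hOV : ∀ i y, v y ∈ O i ↔ y ∈ i.1.1 := by
    intro i y
    simp [O, hinj.eq_iff]
  obtain ⟨ρ, hρ⟩ := SmoothPartitionOfUnity.exists_isSubordinate 𝓘(ℝ, E)
    (Metric.isClosed_closedBall (x := c) (ε := R)) O hO (fun x hx => by
      obtain ⟨y, rfl⟩ := hball hx
      obtain ⟨V, hV, hy⟩ := mem_iUnion₂.mp (ht (mem_univ y))
      exact mem_iUnion.mpr ⟨⟨V, hV⟩, (hOV _ _).mpr hy⟩)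
  have hρV : ∀ i y, ρ i (v y) ≠ 0 → y ∈ i.1.1 := fun i y hy =>
    (hOV i y).mp (hρ i (subset_tsupport _ hy))
  have hρ1 : ∀ x ∈ Metric.closedBall c R, ∑ i, ρ i x = 1 := fun x hx => by
    rw [← finsum_eq_sum_of_fintype]
    exact ρ.sum_eq_one hx
  set f : E → E := fun x => ∑ i, ρ i x • p i.1 with hf
  have hfd : ContDiff ℝ 1 f := by
    refine ContDiff.sum fun i _ => ContDiff.smul ?_ contDiff_const
    exact ((ρ i).contMDiff.contDiff).of_le (by exact_mod_cast le_top)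
  have hfc : ∀ x ∈ Metric.closedBall c R, ‖f x - x‖ ≤ R / 16 := by
    intro x hx
    obtain ⟨y, rfl⟩ := hball hx
    have h1 : f (v y) - v y = ∑ i, ρ i (v y) • (p i.1 - v y) := by
      simp only [hf, smul_sub, Finset.sum_sub_distrib, ← Finset.sum_smul, hρ1 _ hx, one_smul]
    rw [h1]
    refine (norm_sum_le _ _).trans ?_
    calc ∑ i, ‖ρ i (v y) • (p i.1 - v y)‖ ≤ ∑ i, ρ i (v y) * (R / 16) := by
          refine Finset.sum_le_sum fun i _ => ?_
          rw [norm_smul, Real.norm_eq_abs, abs_of_nonneg (ρ.nonneg i _)]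
          by_cases h0 : ρ i (v y) = 0
          · simp [h0]
          · refine mul_le_mul_of_nonneg_left ?_ (ρ.nonneg i _)
            have := hp i.1 (hρV i y h0)
            rw [mem_preimage, mem_ball_iff_norm, norm_sub_rev] at this
            exact this.le
      _ = R / 16 := by rw [← Finset.sum_mul, hρ1 _ hx, one_mul]
  have hspan : f '' Metric.closedBall c R ⊆
      ⋃ s ∈ {s : Finset t | s.card ≤ Module.finrank ℝ E},
        (affineSpan ℝ ((fun i : t => p i.1) '' s) : Set E) := by
    rintro _ ⟨x, hx, rfl⟩
    obtain ⟨y, rfl⟩ := hball hx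
    set s : Finset t := Finset.univ.filter fun i => y ∈ i.1.1 with hs
    have hs0 : ∀ i ∉ s, ρ i (v y) = 0 := fun i hi => by
      by_contra h0
      exact hi (Finset.mem_filter.mpr ⟨Finset.mem_univ i, hρV i y h0⟩)
    have hcard : s.card ≤ Module.finrank ℝ E := by
      obtain ⟨hfin, hle, -⟩ := hVn y
      rw [sub_add_cancel, Int.toNat_natCast] at hle
      refine le_trans ?_ hle
      rw [← Finset.card_image_of_injective s
        (Subtype.val_injective.comp Subtype.val_injective : Function.Injective
          fun i : t => i.1.1), ← ncard_coe_finset]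
      refine ncard_le_ncard ?_ hfin
      intro V hV
      obtain ⟨i, hi, rfl⟩ := Finset.mem_image.mp (Finset.mem_coe.mp hV)
      exact ⟨i.1.2, (Finset.mem_filter.mp hi).2⟩
    refine mem_biUnion (show s ∈ {s : Finset t | _} from hcard) ?_
    have h1 : f (v y) = ∑ i ∈ s, ρ i (v y) • p i.1 := by
      refine (Finset.sum_subset (Finset.subset_univ s) fun i _ hi => ?_).symm
      rw [hs0 i hi, zero_smul]
    rw [h1]
    refine (AffineSubspace.convex _).sum_mem (fun i _ => ρ.nonneg i _) ?_ fun i hi =>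
      subset_affineSpan ℝ _ (mem_image_of_mem _ hi)
    rw [← hρ1 _ hx]
    exact Finset.sum_subset (Finset.subset_univ s) fun i _ hi => hs0 i hi
  have hnull : volume (Metric.closedBall c (R / 2)) = 0 := by
    refine measure_mono_null ((closedBall_subset_image_of_close hfd hR hfc).trans hspan) ?_
    refine (measure_biUnion_null_iff (to_countable _)).mpr fun s hs => ?_
    exact Measure.addHaar_affineSubspace _ _ (affineSpan_image_ne_top _ s hs)
  exact (Metric.measure_closedBall_pos volume c (by positivity)).ne' hnull

end LowerBound

lemma CovDimLE.mono {Y : Type*} [TopologicalSpace Y] {m n : ℤ} (h : CovDimLE Y m) (hmn : m ≤ n) :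
    CovDimLE Y n := by
  intro 𝒰 hUo hUc
  obtain ⟨𝒱, h1, h2, h3, h4⟩ := h 𝒰 hUo hUc
  refine ⟨𝒱, h1, h2, h3, fun y => ?_⟩
  obtain ⟨h5, h6, h7⟩ := h4 y
  exact ⟨h5, h6.trans (Int.toNat_le_toNat (by omega)), by omega⟩

lemma CovDimLE.nonneg {Y : Type*} [TopologicalSpace Y] [Nonempty Y] {n : ℤ} (h : CovDimLE Y n) :
    0 ≤ n := by
  obtain ⟨𝒱, -, hVc, -, hn⟩ := h {univ} (by simp) (by simp)
  obtain ⟨y⟩ := ‹Nonempty Y›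
  obtain ⟨h5, h6, h7⟩ := hn y
  obtain ⟨V, hV, hy⟩ : y ∈ ⋃₀ 𝒱 := hVc ▸ mem_univ y
  have : 0 < ({V ∈ 𝒱 | y ∈ V}).ncard := (ncard_pos h5).mpr ⟨V, hV, hy⟩
  omega

section TitsComparison

variable {X : Type*} [MetricSpace X] {p : X}

/-- The point of the cone represented by a unit speed ray. -/
def IsGeodesicRay.toCone {r : ℝ → X} (h : IsGeodesicRay r) (h0 : r 0 = p) : RayCone p :=
  RayCone.ofRay r h0 zero_le_one h.hasSpeedOn

lemma Real.le_arcsin {x : ℝ} (h0 : 0 ≤ x) (h1 : x ≤ 1) : x ≤ Real.arcsin x := by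
  rw [Real.le_arcsin_iff_sin_le' ⟨by linarith [Real.pi_pos], by linarith [Real.pi_gt_three]⟩]
  exact Real.sin_le h0

lemma Real.arcsin_le_two_mul {x : ℝ} (h0 : 0 ≤ x) (h1 : x ≤ 1) : Real.arcsin x ≤ 2 * x := by
  have h := Real.mul_le_sin (Real.arcsin_nonneg.mpr h0) (Real.arcsin_le_pi_div_two x)
  rw [Real.sin_arcsin (by linarith) h1, div_mul_eq_mul_div, div_le_iff₀ Real.pi_pos] at h
  nlinarith [Real.pi_le_four]

variable [CAT0Space X]

lemma IsGeodesicRay.nrm_toCone {r : ℝ → X} (h : IsGeodesicRay r) (h0 : r 0 = p) :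
    MetricCone.nrm (h.toCone h0) = 1 := by
  rw [MetricCone.nrm]
  exact (RayCone.dist_const _).trans (RayCone.speed_ofRay _ _ _ _)

lemma IsGeodesicRay.tendsto_dist_div {r r' : ℝ → X} (h : IsGeodesicRay r) (h0 : r 0 = p)
    (h' : IsGeodesicRay r') (h0' : r' 0 = p) :
    Tendsto (fun t => dist (r t) (r' t) / t) atTop (𝓝 (dist (h.toCone h0) (h'.toCone h0'))) := by
  refine (RayCone.tendsto_ratio (h.toCone h0) (h'.toCone h0')).congr' ?_
  filter_upwards [eventually_ge_atTop 0] with t ht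
  rw [toCone, toCone, RayCone.ofRay_apply _ _ _ _ ht, RayCone.ofRay_apply _ _ _ _ ht]

lemma IsGeodesicRay.dist_toCone_le_two {r r' : ℝ → X} (h : IsGeodesicRay r) (h0 : r 0 = p)
    (h' : IsGeodesicRay r') (h0' : r' 0 = p) : dist (h.toCone h0) (h'.toCone h0') ≤ 2 := by
  have h1 := dist_triangle_left (h.toCone h0) (h'.toCone h0') MetricCone.apex
  have h2 := h.nrm_toCone h0
  have h3 := h'.nrm_toCone h0'
  rw [MetricCone.nrm] at h2 h3
  linarith

lemma angularDist_eq {r r' : ℝ → X} (h : IsGeodesicRay r) (h0 : r 0 = p)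
    (h' : IsGeodesicRay r') (h0' : r' 0 = p) :
    angularDist r r' = 2 * Real.arcsin (dist (h.toCone h0) (h'.toCone h0') / 2) := by
  refine Tendsto.limUnder_eq ?_
  have h1 := (h.tendsto_dist_div h0 h' h0').div_const 2
  refine (((Real.continuous_arcsin.tendsto _).comp h1).const_mul 2).congr fun t => ?_
  simp only [Function.comp_apply, div_div, mul_comm t 2]

lemma edist_toCone_le_angularDist {r r' : ℝ → X} (h : IsGeodesicRay r) (h0 : r 0 = p)
    (h' : IsGeodesicRay r') (h0' : r' 0 = p) :
    edist (h.toCone h0) (h'.toCone h0') ≤ ENNReal.ofReal (angularDist r r') := by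
  rw [edist_dist, angularDist_eq h h0 h' h0']
  refine ENNReal.ofReal_le_ofReal ?_
  have := Real.le_arcsin (x := dist (h.toCone h0) (h'.toCone h0') / 2) (by positivity)
    (by linarith [h.dist_toCone_le_two h0 h' h0'])
  linarith

/-- The chordal distance is bounded by the Tits distance. -/
lemma edist_toCone_le_titsDist {r r' : ℝ → X} (h : IsGeodesicRay r) (h0 : r 0 = p)
    (h' : IsGeodesicRay r') (h0' : r' 0 = p) :
    edist (h.toCone h0) (h'.toCone h0') ≤ titsDist p r r' := by
  classical
  refine le_iInf ?_
  rintro ⟨⟨n, c⟩, rfl, rfl, hc⟩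
  simp only at hc ⊢
  set δ : ℕ → RayCone p := fun i =>
    if hi : IsGeodesicRay (c i) ∧ c i 0 = p then hi.1.toCone hi.2 else MetricCone.apex with hδ
  have h1 : ∀ i (hi : i ≤ n), δ i = (hc i hi).1.toCone (hc i hi).2 := fun i hi => by
    simp only [hδ]
    rw [dif_pos (hc i hi)]
  have h2 := edist_le_range_sum_edist δ n
  rw [h1 0 n.zero_le, h1 n le_rfl] at h2
  refine h2.trans (Finset.sum_le_sum fun i hi => ?_)
  rw [Finset.mem_range] at hi
  rw [h1 i hi.le, h1 (i + 1) hi]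
  exact edist_toCone_le_angularDist _ _ _ _

/-- The Tits distance is at most twice the chordal distance. -/
lemma titsDist_le_two_mul_edist_toCone {r r' : ℝ → X} (h : IsGeodesicRay r) (h0 : r 0 = p)
    (h' : IsGeodesicRay r') (h0' : r' 0 = p) :
    titsDist p r r' ≤ 2 * edist (h.toCone h0) (h'.toCone h0') := by
  have hchain : ∀ i ≤ 1, IsGeodesicRay (if i = 0 then r else r') ∧
      (if i = 0 then r else r') 0 = p := by
    intro i _
    by_cases hi : i = 0
    · simpa [hi] using ⟨h, h0⟩
    · simpa [hi] using ⟨h', h0'⟩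
  refine (iInf_le _ ⟨(1, fun i => if i = 0 then r else r'), by simp, by simp, hchain⟩).trans ?_
  simp only [Finset.range_one, Finset.sum_singleton, if_true, zero_add, one_ne_zero, if_false]
  rw [angularDist_eq h h0 h' h0', edist_dist, ← ENNReal.ofReal_ofNat,
    ← ENNReal.ofReal_mul zero_le_two]
  refine ENNReal.ofReal_le_ofReal ?_
  have := Real.arcsin_le_two_mul (x := dist (h.toCone h0) (h'.toCone h0') / 2) (by positivity)
    (by linarith [h.dist_toCone_le_two h0 h' h0'])
  linarith

/-- The Tits boundary embeds in the unit sphere of the cone. -/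
lemma IsTitsBoundary.exists_embedding {B : Type*} [EMetricSpace B]
    {φ : {r : ℝ → X // IsGeodesicRay r ∧ r 0 = p} → B} (hφ : IsTitsBoundary p φ) :
    ∃ τ : B → RayCone p, Continuous τ ∧ Function.Injective τ ∧ ∀ b, MetricCone.nrm (τ b) = 1 := by
  set σ := Function.surjInv hφ.1
  have hσ : ∀ b, φ (σ b) = b := Function.surjInv_eq hφ.1
  set τ : B → RayCone p := fun b => (σ b).2.1.toCone (σ b).2.2
  refine ⟨τ, ?_, ?_, fun b => (σ b).2.1.nrm_toCone (σ b).2.2⟩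
  · refine LipschitzWith.continuous (K := 1) fun b b' => ?_
    rw [ENNReal.coe_one, one_mul]
    conv_rhs => rw [← hσ b, ← hσ b', hφ.2]
    exact edist_toCone_le_titsDist _ _ _ _
  · refine AntilipschitzWith.injective (K := 2) fun b b' => ?_
    conv_lhs => rw [← hσ b, ← hσ b', hφ.2]
    exact titsDist_le_two_mul_edist_toCone _ _ _ _

end TitsComparison

section ConeToBoundary

variable {X T : Type*} [MetricSpace X] [MetricSpace T] {t₀ : T} {p : X}

/-- The factor by which the ray `c` is slowed down so that, together with a motion at the same
speed along the line factor, it has unit speed. -/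
noncomputable def RayCone.slope (c : RayCone t₀) : ℝ := (Real.sqrt (1 + c.speed ^ 2))⁻¹

lemma RayCone.slope_pos (c : RayCone t₀) : 0 < c.slope :=
  inv_pos.mpr (Real.sqrt_pos.mpr (by positivity))

lemma RayCone.slope_sq_mul (c : RayCone t₀) : c.slope ^ 2 * (1 + c.speed ^ 2) = 1 := by
  rw [slope, inv_pow, Real.sq_sqrt (by positivity)]
  exact inv_mul_cancel₀ (by positivity)

lemma RayCone.isGeodesicRay_of_product {f : ℝ × T → X}
    (hf : ∀ a b : ℝ × T, dist (f a) (f b) ^ 2 = (a.1 - b.1) ^ 2 + dist a.2 b.2 ^ 2)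
    (c : RayCone t₀) : IsGeodesicRay fun t => f (c.slope * t, c.1 (c.slope * t)) := by
  intro s t hs ht
  rw [← sq_eq_sq₀ dist_nonneg (abs_nonneg _), hf, sq_abs]
  have h := c.hasSpeedOn _ (mem_Ici.mpr (mul_nonneg c.slope_pos.le hs)) _
    (mem_Ici.mpr (mul_nonneg c.slope_pos.le ht))
  dsimp only
  rw [h, mul_pow, sq_abs]
  linear_combination (s - t) ^ 2 * c.slope_sq_mul

variable [CAT0Space T] [CAT0Space X]

lemma RayCone.continuous_slope : Continuous (RayCone.slope (t₀ := t₀)) := by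
  have h : Continuous (RayCone.speed (t₀ := t₀)) :=
    (continuous_const.dist continuous_id).congr RayCone.dist_const
  exact (by fun_prop : Continuous fun c : RayCone t₀ => Real.sqrt (1 + c.speed ^ 2)).inv₀
    fun c => (Real.sqrt_pos.mpr (by positivity)).ne'

/-- An embedding of `ℝ × T` in `X` induces a map of the cone of `T` to the rays in `X`. -/
lemma exists_rays_of_product [ProperSpace X] {f : ℝ × T → X}
    (hf : ∀ a b : ℝ × T, dist (f a) (f b) ^ 2 = (a.1 - b.1) ^ 2 + dist a.2 b.2 ^ 2)
    (t₀ : T) (p : X) :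
    ∃ R : RayCone t₀ → {r : ℝ → X // IsGeodesicRay r ∧ r 0 = p}, ∀ x y,
      dist ((R x).2.1.toCone (R x).2.2) ((R y).2.1.toCone (R y).2.2) ^ 2 =
        (x.slope - y.slope) ^ 2 +
          dist (MetricCone.scale x.slope x) (MetricCone.scale y.slope y) ^ 2 := by
  choose r hr hr0 hrd using fun x : RayCone t₀ =>
    exists_asymptotic_ray (x.isGeodesicRay_of_product hf) p
  refine ⟨fun x => ⟨r x, hr x, hr0 x⟩, fun x y => ?_⟩
  set F : RayCone t₀ → ℝ → X := fun x t => f (x.slope * t, x.1 (x.slope * t)) with hF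
  have h1 : Tendsto (fun t => (dist (F x t) (F y t) / t) ^ 2) atTop
      (𝓝 ((x.slope - y.slope) ^ 2 +
          dist (MetricCone.scale x.slope x) (MetricCone.scale y.slope y) ^ 2)) := by
    refine (((RayCone.tendsto_ratio (RayCone.dilate x.slope x) (RayCone.dilate y.slope y)).pow
      2).const_add _).congr' ?_
    filter_upwards [eventually_gt_atTop 0] with t ht
    rw [RayCone.dilate_apply x.slope_pos.le, RayCone.dilate_apply y.slope_pos.le, div_pow, div_pow,
      hf]
    field_simp
  have h2 := ((hr x).tendsto_dist_div (hr0 x) (hr y) (hr0 y))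
  have h3 : Tendsto (fun t => dist (F x t) (F y t) / t - dist (r x t) (r y t) / t) atTop
      (𝓝 0) := by
    refine squeeze_zero_norm' (a := fun t => (dist p (F x 0) + dist p (F y 0)) / t) ?_
      (tendsto_const_nhds.div_atTop tendsto_id)
    filter_upwards [eventually_gt_atTop 0] with t ht
    rw [← sub_div, norm_div, Real.norm_eq_abs, Real.norm_eq_abs, abs_of_pos ht]
    gcongr
    have h4 := hrd x t ht.le
    have h5 := hrd y t ht.le
    rw [dist_comm] at h4 h5
    rw [← Real.dist_eq]
    exact (dist_dist_dist_le _ _ _ _).trans (add_le_add h4 h5)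
  have h4 := (h2.add h3).pow 2
  simp only [add_sub_cancel, add_zero] at h4
  exact tendsto_nhds_unique h4 h1

/-- The cone of `T` embeds in the Tits boundary of `X` if `ℝ × T` embeds in `X`. -/
lemma exists_embedding_rayCone [ProperSpace X] {B : Type*} [EMetricSpace B] {f : ℝ × T → X}
    (hf : ∀ a b : ℝ × T, dist (f a) (f b) ^ 2 = (a.1 - b.1) ^ 2 + dist a.2 b.2 ^ 2)
    (t₀ : T) {φ : {r : ℝ → X // IsGeodesicRay r ∧ r 0 = p} → B} (hφ : IsTitsBoundary p φ) :
    ∃ e : RayCone t₀ → B, Continuous e ∧ Function.Injective e := by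
  obtain ⟨R, hR⟩ := exists_rays_of_product hf t₀ p
  set γ : RayCone t₀ → RayCone p := fun x => (R x).2.1.toCone (R x).2.2 with hγ
  have hγc : Continuous γ := by
    rw [continuous_iff_continuousAt]
    intro x
    rw [ContinuousAt, tendsto_iff_dist_tendsto_zero]
    have h1 : Continuous fun y : RayCone t₀ => Real.sqrt ((y.slope - x.slope) ^ 2 +
        (y.slope * dist y x + |y.slope - x.slope| * dist MetricCone.apex x) ^ 2) := by
      have := RayCone.continuous_slope (t₀ := t₀)
      fun_prop
    have h2 := h1.tendsto x
    simp only [dist_self, sub_self, abs_zero, mul_zero, zero_mul, add_zero, ne_eq,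
      OfNat.ofNat_ne_zero, not_false_eq_true, zero_pow, Real.sqrt_zero] at h2
    refine squeeze_zero (fun _ => dist_nonneg) (fun y => ?_) h2
    refine Real.le_sqrt_of_sq_le ?_
    rw [hR]
    gcongr
    refine (dist_triangle _ (MetricCone.scale y.slope x) _).trans_eq ?_
    rw [MetricCone.dist_scale y.slope_pos.le, MetricCone.dist_scale_self y.slope_pos.le
      x.slope_pos.le]
  have hγi : Function.Injective γ := by
    intro x y hxy
    have h := hR x y
    rw [dist_eq_zero.mpr hxy, zero_pow two_ne_zero] at h
    have h1 : x.slope = y.slope := by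
      nlinarith [sq_nonneg (x.slope - y.slope),
        sq_nonneg (dist (MetricCone.scale x.slope x) (MetricCone.scale y.slope y))]
    rw [h1, sub_self, zero_pow two_ne_zero, zero_add, MetricCone.dist_scale y.slope_pos.le] at h
    have h2 := pow_eq_zero_iff two_ne_zero |>.mp h.symm
    exact dist_eq_zero.mp ((mul_eq_zero.mp h2).resolve_left y.slope_pos.ne')
  refine ⟨fun x => φ (R x), ?_, fun x y hxy => hγi ?_⟩
  · rw [continuous_iff_continuousAt]
    intro x
    rw [ContinuousAt, tendsto_iff_edist_tendsto_0]
    have h1 : Tendsto (fun y => 2 * edist (γ y) (γ x)) (𝓝 x) (𝓝 0) := by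
      simpa using ENNReal.Tendsto.const_mul
        (tendsto_iff_edist_tendsto_0.mp (hγc.tendsto x)) (Or.inr ENNReal.ofNat_ne_top)
    refine tendsto_of_tendsto_of_tendsto_of_le_of_le tendsto_const_nhds h1
      (fun _ => zero_le) fun y => ?_
    dsimp only
    rw [hφ.2]
    exact titsDist_le_two_mul_edist_toCone _ _ _ _
  · have h := edist_toCone_le_titsDist (R x).2.1 (R x).2.2 (R y).2.1 (R y).2.2
    rw [← hφ.2, show φ (R x) = φ (R y) from hxy, edist_self] at h
    exact edist_eq_zero.mp (le_antisymm h zero_le)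

end ConeToBoundary

/-- A compact set with a continuous injective map to `ℝ^ι` whose image has interior, and which
embeds in `B`, forces the dimension of `B` to be at least the cardinality of `ι`. -/
lemma BoundaryDimLE.card_le {B C ι : Type*} [EMetricSpace B] [TopologicalSpace C] [Fintype ι]
    {N : ℕ} (hB : BoundaryDimLE B N) {e : C → B} (he : Continuous e) (hei : Function.Injective e)
    {Q : Set C} (hQ : IsCompact Q) {u : C → ι → ℝ} (hu : Continuous u) (hui : InjOn u Q)
    (hint : (interior (u '' Q)).Nonempty) : Fintype.card ι ≤ N := by
  by_contra! hlt
  have : CompactSpace Q := isCompact_iff_compactSpace.mp hQ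
  have hK : IsCompact (e '' Q) := hQ.image he
  have : CompactSpace (e '' Q) := isCompact_iff_compactSpace.mp hK
  let h : Q ≃ₜ e '' Q := Continuous.homeoOfEquivCompactToT2 (f := Equiv.Set.image e Q hei)
    ((he.comp continuous_subtype_val).subtype_mk _)
  have hdim : CovDimLE (e '' Q) ((Module.finrank ℝ (EuclideanSpace ℝ ι) : ℤ) - 1) := by
    refine (hB _ hK).mono ?_
    rw [finrank_euclideanSpace]
    omega
  let ψ : (ι → ℝ) ≃ₜ EuclideanSpace ℝ ι := (EuclideanSpace.equiv ι ℝ).symm.toHomeomorph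
  have hE := interior_range_eq_empty_of_covDimLE hdim
    (v := fun z => ψ (u (h.symm z))) (by fun_prop) (by
      intro z z' hz
      exact h.symm.injective (Subtype.ext (hui (h.symm z).2 (h.symm z').2 (ψ.injective hz))))
  have hr : range (fun z => ψ (u (h.symm z))) = ψ '' (u '' Q) := by
    refine (h.symm.surjective.range_comp fun z : Q => ψ (u z)).trans ?_
    rw [image_image, image_eq_range]
  rw [hr, ← ψ.image_interior, image_eq_empty] at hE
  exact hint.ne_empty hE

/-- If `ℝ × T` embeds in `X`, then the dimension of the Tits boundary of `T` is smaller than the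
dimension of the Tits boundary of `X`. -/
lemma boundaryDimLE_of_product {X T BX BT : Type*} [MetricSpace X] [ProperSpace X] [CAT0Space X]
    [MetricSpace T] [ProperSpace T] [CAT0Space T] [EMetricSpace BX] [EMetricSpace BT] {p : X}
    {f : ℝ × T → X}
    (hf : ∀ a b : ℝ × T, dist (f a) (f b) ^ 2 = (a.1 - b.1) ^ 2 + dist a.2 b.2 ^ 2)
    {φX : {r : ℝ → X // IsGeodesicRay r ∧ r 0 = p} → BX} (hBX : IsTitsBoundary p φX)
    {t₀ : T} {φT : {r : ℝ → T // IsGeodesicRay r ∧ r 0 = t₀} → BT} (hBT : IsTitsBoundary t₀ φT)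
    {d : ℤ} (hd : BoundaryDimLE BX d) : BoundaryDimLE BT (d - 1) := by
  intro K hK
  obtain ⟨e, he, hei⟩ := exists_embedding_rayCone hf t₀ hBX
  have hd0 : 0 ≤ d := (hd {e (RayCone.const t₀)} isCompact_singleton).nonneg
  lift d to ℕ using hd0
  obtain ⟨τ, hτ, hτi, hτn⟩ := hBT.exists_embedding
  have : CompactSpace K := isCompact_iff_compactSpace.mp hK
  exact MetricCone.covDimLE_of_injective (τ := fun y : K => τ y) (hτ.comp continuous_subtype_val)
    (hτi.comp Subtype.val_injective) (fun y => hτn y)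
    fun ι _ Q hQ u hu hui hint => hd.card_le he hei hQ hu hui hint

end

/-- Let `X` be a proper CAT(0) space and `ξ ∈ ∂X` a radial limit point, i.e. there is a
sequence of isometries `(gₙ)` of `X` and a ray `r₀` pointing to `ξ` such that
`gₙ⁻¹ r₀(0)` goes to infinity while staying at bounded distance from `r₀`.  Let `T = X_ξ`
be the transverse space of `ξ` (the metric completion of the rays pointing to `ξ`,
with the infimal pseudometric `d_ξ`).  Then the geometric dimension of the Tits boundary
of `X_ξ` satisfies `dim ∂X_ξ ≤ dim ∂X − 1`; in particular there is an isometric embedding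
`ℝ × X_ξ → X`. -/
theorem transverse_boundary_dim_and_embedding
    {X T BX BT : Type*} [MetricSpace X] [ProperSpace X] [CompleteSpace X] [CAT0Space X]
    [MetricSpace T] [CompleteSpace T] [EMetricSpace BX] [EMetricSpace BT]
    -- the point `ξ ∈ ∂X`, represented by a geodesic ray `r₀`:
    (r₀ : ℝ → X) (hr₀ : IsGeodesicRay r₀)
    -- `ξ` is a radial limit point, via the sequence of isometries `gₙ`:
    (g : ℕ → X ≃ᵢ X)
    (hrad₁ : ∃ M : ℝ, ∀ n : ℕ, ∃ t : ℝ, 0 ≤ t ∧ dist ((g n).symm (r₀ 0)) (r₀ t) ≤ M)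
    (hrad₂ : Tendsto (fun n => dist (r₀ 0) ((g n).symm (r₀ 0))) atTop atTop)
    -- `T` is the transverse space `X_ξ`: the completion of the rays pointing to `ξ`
    -- equipped with the pseudometric `d_ξ`:
    (q : {r : ℝ → X // IsGeodesicRay r ∧ Asymptotic r r₀} → T)
    (hq : DenseRange q) (hqd : ∀ r r', dist (q r) (q r') = transDist r.1 r'.1)
    -- the Tits boundaries of `X` and of `X_ξ`:
    (φX : {r : ℝ → X // IsGeodesicRay r ∧ r 0 = r₀ 0} → BX)
    (hBX : IsTitsBoundary (r₀ 0) φX)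
    (t₀ : T) (φT : {r : ℝ → T // IsGeodesicRay r ∧ r 0 = t₀} → BT)
    (hBT : IsTitsBoundary t₀ φT) :
    (∀ d : ℤ, BoundaryDimLE BX d → BoundaryDimLE BT (d - 1)) ∧
      ∃ f : ℝ × T → X, ∀ a b : ℝ × T,
        dist (f a) (f b) ^ 2 = (a.1 - b.1) ^ 2 + dist a.2 b.2 ^ 2 := by
  obtain ⟨f, hf⟩ := exists_product_embedding r₀ hr₀ g hrad₁ hrad₂ q hq hqd
  have hi := isometry_slice hf 0
  have : ProperSpace T := hi.properSpace_of_complete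
  have : CAT0Space T := CAT0Space.of_isometry hi (exists_midpoint_transverse q hq hqd)
  exact ⟨fun d hd => boundaryDimLE_of_product hf hBX hBT hd, f, hf⟩
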